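/- arXiv:1305.0729 — 2 statements merged into one kernel-verified Lean document; each statement's English description precedes it below -/
import Mathlib

section
/- Let n ≥ 5 be odd. Let A ∈ GL_n(ℤ) be the Levelt companion matrix of P(x) = xⁿ + 2xⁿ⁻¹ + 2xⁿ⁻² + ⋯ + 2x + 1 and let B ∈ GL_n(ℤ) be the Levelt companion matrix of Q(x) = xⁿ − xⁿ⁻¹ + xⁿ⁻² − ⋯ + x − 1. Then there exists a nonzero symmetric matrix F ∈ M_n(ℚ) with AᵗFA = F and BᵗFB = F, and for every such F, the subgroup of GL_n(ℤ) generated by A and B has infinite index in the group O_F(ℤ) := {g ∈ GL_n(ℤ) : gᵗFg = F}. (The group ⟨A,B⟩ is the hyperbolic hypergeometric monodromy group of the family 𝒩₁(1,n,n), i.e. of α = (0, 1/(n+1), …, (n−1)/(2(n+1)), (n+3)/(2(n+1)), …, n/(n+1)), β = (1/2, 1/n, 2/n, …, (n−1)/n); the theorem says it is thin.) -/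
open Matrix

/-- Cast an integer matrix to a rational matrix. -/
def qm {n : ℕ} (F : Matrix (Fin n) (Fin n) ℤ) : Matrix (Fin n) (Fin n) ℚ :=
  F.map (fun x => (x : ℚ))

/-- The Levelt companion matrix of the monic polynomial
`xⁿ + c 1 * xⁿ⁻¹ + ⋯ + c (n-1) * x + c n`: it has `1`'s in positions `(i+1, i)`,
last column `(-c n, -c (n-1), …, -c 1)ᵗ`, and zeros elsewhere. -/
def levelt (n : ℕ) (c : ℕ → ℤ) : Matrix (Fin n) (Fin n) ℤ :=
  Matrix.of fun i j =>
    if (j : ℕ) = n - 1 then -c (n - (i : ℕ))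
    else if (i : ℕ) = (j : ℕ) + 1 then 1 else 0

/-- The monoid homomorphism `GL_n(ℤ) →* M_n(ℚ)` sending an integral invertible matrix to
its rational incarnation. -/
def glq (n : ℕ) : (Matrix (Fin n) (Fin n) ℤ)ˣ →* Matrix (Fin n) (Fin n) ℚ :=
  ((Int.castRingHom ℚ).mapMatrix.toMonoidHom).comp
    (Units.coeHom (Matrix (Fin n) (Fin n) ℤ))

/-- The integral orthogonal group `O_F(ℤ) = {g ∈ GL_n(ℤ) : gᵗ F g = F}` of a rational
quadratic form `F`, as a subgroup of `GL_n(ℤ)`. -/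
def OFgrp (n : ℕ) (F : Matrix (Fin n) (Fin n) ℚ) :
    Subgroup (Matrix (Fin n) (Fin n) ℤ)ˣ where
  carrier := {g | (glq n g)ᵀ * F * glq n g = F}
  one_mem' := by
    show (glq n 1)ᵀ * F * glq n 1 = F
    rw [_root_.map_one]
    simp
  mul_mem' := by
    intro g h hg hh
    simp only [Set.mem_setOf_eq] at *
    calc (glq n (g * h))ᵀ * F * glq n (g * h)
        = (glq n h)ᵀ * ((glq n g)ᵀ * F * glq n g) * glq n h := by
          rw [_root_.map_mul, Matrix.transpose_mul]; noncomm_ring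
      _ = F := by rw [hg, hh]
  inv_mem' := by
    intro g hg
    simp only [Set.mem_setOf_eq] at *
    have h2 : glq n g * glq n g⁻¹ = 1 := by
      rw [← _root_.map_mul, mul_inv_cancel, _root_.map_one]
    calc (glq n g⁻¹)ᵀ * F * glq n g⁻¹
        = (glq n g⁻¹)ᵀ * ((glq n g)ᵀ * F * glq n g) * glq n g⁻¹ := by rw [hg]
      _ = (glq n g * glq n g⁻¹)ᵀ * F * (glq n g * glq n g⁻¹) := by
          rw [Matrix.transpose_mul]; noncomm_ring
      _ = F := by rw [h2]; simp

/-- Coefficients of `P(x) = xⁿ + 2xⁿ⁻¹ + 2xⁿ⁻² + ⋯ + 2x + 1`. -/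
def cP10 (n : ℕ) : ℕ → ℤ := fun k => if k = n then 1 else 2

/-- Coefficients of `Q(x) = xⁿ - xⁿ⁻¹ + xⁿ⁻² - ⋯ + x - 1` (for odd `n`). -/
def cQalt : ℕ → ℤ := fun k => (-1) ^ k

/-! ### Reflection groups of integral simple systems -/

section SimpleSystem

variable {E S : Type*} [AddCommGroup E]

/-- The reflection `x ↦ x - b(x, v) v` in a vector `v` with `b(v, v) = 2`. -/
def rootReflection (b : LinearMap.BilinForm ℤ E) (v : E) : E →ₗ[ℤ] E :=
  LinearMap.id - (b.flip v).smulRight v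

@[simp]
lemma rootReflection_apply (b : LinearMap.BilinForm ℤ E) (v x : E) :
    rootReflection b v x = x - b x v • v := rfl

/-- A family of vectors of norm `2` with pairwise nonpositive products. -/
structure IsSimpleSystem (b : LinearMap.BilinForm ℤ E) (α : S → E) : Prop where
  symm : ∀ x y, b x y = b y x
  norm : ∀ s, b (α s) (α s) = 2
  nonpos : ∀ s t, s ≠ t → b (α s) (α t) ≤ 0

/-- Membership in the open chamber of a simple system. -/
def InChamber (b : LinearMap.BilinForm ℤ E) (α : S → E) (x : E) : Prop :=
  ∀ s, 0 < b x (α s)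

/-- A vector is positive if it pairs positively with the open chamber. -/
def IsPositive (b : LinearMap.BilinForm ℤ E) (α : S → E) (v : E) : Prop :=
  ∀ x, InChamber b α x → 0 < b x v

/-- The roots: the orbit of the simple roots under the group generated by the reflections. -/
inductive IsRoot (b : LinearMap.BilinForm ℤ E) (α : S → E) : E → Prop
  | simple (s : S) : IsRoot b α (α s)
  | reflect (s : S) (x : E) : IsRoot b α x → IsRoot b α (rootReflection b (α s) x)

variable {b : LinearMap.BilinForm ℤ E} {α : S → E}

lemma IsPositive.combination {v w : E} (hv : IsPositive b α v) (hw : IsPositive b α w)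
    {p q : ℤ} (hp : 0 ≤ p) (hq : 0 < q) : IsPositive b α (p • v + q • w) := by
  intro x hx
  have h1 := hv x hx
  have h2 := hw x hx
  simp only [map_add, map_smul, smul_eq_mul]
  nlinarith [mul_nonneg hp h1.le, mul_pos hq h2]

open Classical in
/-- The Coxeter matrix attached to a simple system. -/
noncomputable def IsSimpleSystem.coxeterMatrix (h : IsSimpleSystem b α) : CoxeterMatrix S where
  M := Matrix.of fun s t =>
    if s = t then 1 else if b (α s) (α t) = 0 then 2 else if b (α s) (α t) = -1 then 3 else 0
  isSymm := by
    ext s t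
    simp only [Matrix.transpose_apply, Matrix.of_apply, h.symm (α t) (α s), eq_comm]
  diagonal s := by simp
  off_diagonal s t hst := by
    simp only [Matrix.of_apply, hst, if_false]
    split_ifs <;> simp

lemma IsSimpleSystem.coxeterMatrix_of_zero (h : IsSimpleSystem b α) {s t : S} (hst : s ≠ t)
    (h0 : b (α s) (α t) = 0) : h.coxeterMatrix s t = 2 := by
  simp [coxeterMatrix, hst, h0]

lemma IsSimpleSystem.coxeterMatrix_of_neg_one (h : IsSimpleSystem b α) {s t : S} (hst : s ≠ t)
    (h1 : b (α s) (α t) = -1) : h.coxeterMatrix s t = 3 := by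
  simp [coxeterMatrix, hst, h1]

lemma IsSimpleSystem.isLiftable (h : IsSimpleSystem b α) :
    h.coxeterMatrix.IsLiftable
      (fun s => (rootReflection b (α s) : Module.End ℤ E)) := by
  classical
  intro s t
  by_cases hst : s = t
  · subst hst
    rw [h.coxeterMatrix.diagonal, pow_one]
    ext x
    simp only [Module.End.mul_apply, rootReflection_apply, map_sub, map_smul, h.norm,
      Module.End.one_apply]
    module
  by_cases h0 : b (α s) (α t) = 0
  · rw [h.coxeterMatrix_of_zero hst h0, pow_two]
    have h0' : b (α t) (α s) = 0 := by rw [h.symm, h0]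
    ext x
    simp only [Module.End.mul_apply, rootReflection_apply, map_sub, map_smul, h.norm,
      Module.End.one_apply, h0, h0']
    module
  by_cases h1 : b (α s) (α t) = -1
  · rw [h.coxeterMatrix_of_neg_one hst h1, pow_succ, pow_two]
    have h1' : b (α t) (α s) = -1 := by rw [h.symm, h1]
    ext x
    simp only [Module.End.mul_apply, rootReflection_apply, map_sub, map_smul, h.norm,
      Module.End.one_apply, h1, h1']
    module
  · have : h.coxeterMatrix s t = 0 := by simp [coxeterMatrix, hst, h0, h1]
    rw [this, pow_zero]

/-- The Coxeter system attached to a simple system. -/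
noncomputable def IsSimpleSystem.cs (h : IsSimpleSystem b α) :
    CoxeterSystem h.coxeterMatrix h.coxeterMatrix.Group :=
  h.coxeterMatrix.toCoxeterSystem

/-- The geometric representation of the Coxeter group of a simple system. -/
noncomputable def IsSimpleSystem.rep (h : IsSimpleSystem b α) :
    h.coxeterMatrix.Group →* Module.End ℤ E :=
  h.cs.lift ⟨_, h.isLiftable⟩

lemma IsSimpleSystem.rep_simple (h : IsSimpleSystem b α) (s : S) :
    h.rep (h.cs.simple s) = rootReflection b (α s) :=
  h.cs.lift_apply_simple h.isLiftable s

lemma IsSimpleSystem.rep_mul_simple_apply (h : IsSimpleSystem b α)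
    (w : h.coxeterMatrix.Group) (s : S) (x : E) :
    h.rep (w * h.cs.simple s) x = h.rep w (x - b x (α s) • α s) := by
  rw [map_mul, h.rep_simple]
  rfl

lemma IsSimpleSystem.rep_apply (h : IsSimpleSystem b α)
    (w : h.coxeterMatrix.Group) (s : S) (x : E) :
    h.rep w x = h.rep (w * h.cs.simple s) (x - b x (α s) • α s) := by
  rw [← h.rep_mul_simple_apply, h.cs.simple_mul_simple_cancel_right]

/-- Sinking along an infinite dihedral parabolic subgroup. -/
lemma IsSimpleSystem.isPositive_of_le_neg_two (h : IsSimpleSystem b α) {n : ℕ}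
    (ih : ∀ w, h.cs.length w < n → ∀ s, ¬ h.cs.IsRightDescent w s →
      IsPositive b α (h.rep w (α s))) (m : ℕ) :
    ∀ w, h.cs.length w = m → m < n → ∀ s t, b (α s) (α t) ≤ -2 → ¬ h.cs.IsRightDescent w t →
      ∀ p q : ℤ, 0 ≤ p → p ≤ q → 0 < q →
        IsPositive b α (h.rep w (p • α s + q • α t)) := by
  induction m using Nat.strong_induction_on with
  | _ m ihm =>
    intro w hw hm s t hst ht p q hp hpq hq
    by_cases hs : h.cs.IsRightDescent w s
    · have hlen := h.cs.isRightDescent_iff.1 hs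
      have hnot := h.cs.isRightDescent_iff_not_isRightDescent_mul.1 hs
      have hts : b (α t) (α s) ≤ -2 := by rw [h.symm]; exact hst
      have key := ihm (h.cs.length (w * h.cs.simple s)) (by omega) _ rfl (by omega) t s hts hnot
        q (-p - q * b (α t) (α s)) (by omega) (by nlinarith) (by nlinarith)
      rw [h.rep_apply w s]
      convert key using 2
      simp only [map_add, map_smul, LinearMap.add_apply, LinearMap.smul_apply, h.norm, smul_eq_mul]
      module
    · rw [map_add, map_smul, map_smul]
      exact (ih w (by omega) s hs).combination (ih w (by omega) t ht) hp hq

theorem IsSimpleSystem.isPositive_rep (h : IsSimpleSystem b α) (n : ℕ) :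
    ∀ w, h.cs.length w = n → ∀ s, ¬ h.cs.IsRightDescent w s →
      IsPositive b α (h.rep w (α s)) := by
  induction n using Nat.strong_induction_on with
  | _ n ih =>
    replace ih : ∀ w, h.cs.length w < n → ∀ s, ¬ h.cs.IsRightDescent w s →
      IsPositive b α (h.rep w (α s)) := fun w hw s hs => ih _ hw w rfl s hs
    intro w hw i hi
    by_cases hw1 : w = 1
    · subst hw1
      intro x hx
      simpa using hx i
    obtain ⟨j, hj⟩ := h.cs.exists_rightDescent_of_ne_one hw1
    have hij : i ≠ j := by rintro rfl; exact hi hj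
    obtain ⟨w', rfl⟩ : ∃ w', w = w' * h.cs.simple j :=
      ⟨w * h.cs.simple j, by simp⟩
    have hlen := h.cs.isRightDescent_iff.1 hj
    have hnot := h.cs.isRightDescent_iff_not_isRightDescent_mul.1 hj
    rw [h.cs.simple_mul_simple_cancel_right] at hlen hnot
    have hposj := ih w' (by omega) j hnot
    have hi' := h.cs.not_isRightDescent_iff.1 hi
    rw [h.rep_mul_simple_apply]
    rcases lt_or_ge (-2) (b (α i) (α j)) with hb | hb
    · have hb0 := h.nonpos i j hij
      obtain hb | hb : b (α i) (α j) = 0 ∨ b (α i) (α j) = -1 := by omega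
      · rw [hb, zero_smul, sub_zero]
        refine ih w' (by omega) i fun hd => ?_
        obtain ⟨w'', rfl⟩ : ∃ w'', w' = w'' * h.cs.simple i := ⟨w' * h.cs.simple i, by simp⟩
        have hlen' := h.cs.isRightDescent_iff.1 hd
        rw [h.cs.simple_mul_simple_cancel_right] at hlen'
        have hrel := h.cs.simple_mul_simple_pow i j
        rw [h.coxeterMatrix_of_zero hij hb, pow_two] at hrel
        have hbraid : h.cs.simple i * h.cs.simple j * h.cs.simple i = h.cs.simple j := by
          have : h.cs.simple i * h.cs.simple j * h.cs.simple i * h.cs.simple j = 1 := by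
            simpa only [mul_assoc] using hrel
          rw [eq_inv_of_mul_eq_one_left this, h.cs.inv_simple]
        have : w'' * h.cs.simple i * h.cs.simple j * h.cs.simple i = w'' * h.cs.simple j := by
          simpa only [mul_assoc] using congrArg (w'' * ·) hbraid
        rw [this] at hi'
        have := h.cs.length_mul_le w'' (h.cs.simple j)
        rw [h.cs.length_simple] at this
        omega
      · have hvec : α i - b (α i) (α j) • α j = (1 : ℤ) • α i + (1 : ℤ) • α j := by
          rw [hb]; module
        rw [hvec]
        by_cases hd : h.cs.IsRightDescent w' i
        · obtain ⟨w'', rfl⟩ : ∃ w'', w' = w'' * h.cs.simple i := ⟨w' * h.cs.simple i, by simp⟩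
          have hlen' := h.cs.isRightDescent_iff.1 hd
          rw [h.cs.simple_mul_simple_cancel_right] at hlen'
          have hb' : b (α j) (α i) = -1 := by rw [h.symm, hb]
          have hvec' : (1 : ℤ) • α i + (1 : ℤ) • α j
              - b ((1 : ℤ) • α i + (1 : ℤ) • α j) (α i) • α i = α j := by
            simp only [map_add, map_smul, LinearMap.add_apply, LinearMap.smul_apply, h.norm, hb']
            module
          rw [h.rep_mul_simple_apply, hvec']
          refine ih w'' (by omega) j fun hd' => ?_
          obtain ⟨w₃, rfl⟩ : ∃ w₃, w'' = w₃ * h.cs.simple j := ⟨w'' * h.cs.simple j, by simp⟩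
          have hlen'' := h.cs.isRightDescent_iff.1 hd'
          rw [h.cs.simple_mul_simple_cancel_right] at hlen''
          have hrel := h.cs.simple_mul_simple_pow i j
          rw [h.coxeterMatrix_of_neg_one hij hb, pow_succ, pow_two] at hrel
          have hbraid : h.cs.simple j * h.cs.simple i * h.cs.simple j * h.cs.simple i
              = h.cs.simple i * h.cs.simple j := by
            have h1 : (h.cs.simple i * h.cs.simple j)⁻¹ = h.cs.simple j * h.cs.simple i := by simp
            have h2 := eq_inv_of_mul_eq_one_left hrel
            rw [h1] at h2
            have h3 := congrArg (·⁻¹) h2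
            simp only [_root_.mul_inv_rev, h.cs.inv_simple] at h3
            simpa only [mul_assoc] using h3
          have : w₃ * h.cs.simple j * h.cs.simple i * h.cs.simple j * h.cs.simple i
              = w₃ * (h.cs.simple i * h.cs.simple j) := by
            rw [← hbraid]; simp only [mul_assoc]
          rw [this] at hi'
          have h1 := h.cs.length_mul_le w₃ (h.cs.simple i * h.cs.simple j)
          have h2 := h.cs.length_mul_le (h.cs.simple i) (h.cs.simple j)
          rw [h.cs.length_simple, h.cs.length_simple] at h2
          omega
        · rw [map_add, map_smul, map_smul]
          exact (ih w' (by omega) i hd).combination hposj zero_le_one zero_lt_one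
    · have := h.isPositive_of_le_neg_two ih _ w' rfl (by omega) i j hb hnot 1 (-b (α i) (α j))
        zero_le_one (by omega) (by omega)
      convert this using 2
      module

lemma IsRoot.exists_rep (h : IsSimpleSystem b α) {v : E} (hv : IsRoot b α v) :
    ∃ w s, v = h.rep w (α s) := by
  induction hv with
  | simple s => exact ⟨1, s, by simp⟩
  | reflect s x _ ih =>
    obtain ⟨w, t, rfl⟩ := ih
    refine ⟨h.cs.simple s * w, t, ?_⟩
    rw [map_mul, h.rep_simple]
    rfl

/-- Every root has a constant sign on the open chamber. -/
theorem IsRoot.isPositive_or_neg (h : IsSimpleSystem b α) {v : E} (hv : IsRoot b α v) :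
    IsPositive b α v ∨ IsPositive b α (-v) := by
  obtain ⟨w, s, rfl⟩ := hv.exists_rep h
  by_cases hs : h.cs.IsRightDescent w s
  · right
    have := h.isPositive_rep _ (w * h.cs.simple s) rfl s
      (h.cs.isRightDescent_iff_not_isRightDescent_mul.1 hs)
    rw [h.rep_mul_simple_apply, h.norm] at this
    convert this using 1
    rw [← map_neg]
    congr 1
    module
  · exact .inl (h.isPositive_rep _ w rfl s hs)

lemma rootReflection_isometry (h : IsSimpleSystem b α) {v : E} (hv : b v v = 2) (x y : E) :
    b (rootReflection b v x) (rootReflection b v y) = b x y := by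
  simp only [rootReflection_apply, map_sub, map_smul, LinearMap.sub_apply, LinearMap.smul_apply,
    smul_eq_mul, hv, h.symm v y]
  ring

lemma IsRoot.norm (h : IsSimpleSystem b α) {v : E} (hv : IsRoot b α v) : b v v = 2 := by
  induction hv with
  | simple s => exact h.norm s
  | reflect s x _ ih => rw [rootReflection_isometry h (h.norm s), ih]

/-- The roots are stable under reflections in roots. -/
lemma IsRoot.rootReflection (h : IsSimpleSystem b α) {v : E} (hv : IsRoot b α v) :
    ∀ {x : E}, IsRoot b α x → IsRoot b α (rootReflection b v x) := by
  induction hv with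
  | simple s => exact fun hx => .reflect s _ hx
  | reflect s v _ ih =>
    intro x hx
    have := IsRoot.reflect s _ (ih (IsRoot.reflect s x hx))
    convert this using 1
    have hs := h.norm s
    simp only [rootReflection_apply, map_sub, map_smul, smul_eq_mul, hs, h.symm (α s) v]
    module

lemma IsRoot.neg (h : IsSimpleSystem b α) {v : E} (hv : IsRoot b α v) : IsRoot b α (-v) := by
  have := hv.rootReflection h hv
  rw [rootReflection_apply, hv.norm h] at this
  convert this using 1
  module

/-- An isometry mapping the simple roots to roots preserves the set of roots. -/
lemma IsRoot.map (h : IsSimpleSystem b α) (f : E →ₗ[ℤ] E) (hf : ∀ x y, b (f x) (f y) = b x y)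
    (hα : ∀ s, IsRoot b α (f (α s))) {v : E} (hv : IsRoot b α v) : IsRoot b α (f v) := by
  induction hv with
  | simple s => exact hα s
  | reflect s x _ ih =>
    have := (hα s).rootReflection h ih
    rwa [rootReflection_apply, hf, ← map_smul, ← map_sub] at this

end SimpleSystem

/-! ### Eichler transformations and chambers -/

section Eichler

variable {E S : Type*} [AddCommGroup E]

/-- The `k`-th power of the Eichler transformation attached to an isotropic vector `l` and
twice a vector `y` orthogonal to `l`. -/
def eichler (b : LinearMap.BilinForm ℤ E) (l y : E) (k : ℤ) : E →ₗ[ℤ] E :=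
  LinearMap.id + (b.flip l).smulRight ((2 * k) • y) - (b.flip y).smulRight ((2 * k) • l)
    - (b.flip l).smulRight ((2 * k ^ 2 * b y y) • l)

lemma eichler_apply (b : LinearMap.BilinForm ℤ E) (l y : E) (k : ℤ) (x : E) :
    eichler b l y k x = x + b x l • (2 * k) • y - b x y • (2 * k) • l
      - b x l • (2 * k ^ 2 * b y y) • l := rfl

variable {b : LinearMap.BilinForm ℤ E} {l y : E}

lemma eichler_zero (x : E) : eichler b l y 0 x = x := by
  rw [eichler_apply]; module

lemma eichler_eichler (hb : ∀ x y, b x y = b y x) (hl : b l l = 0) (hly : b l y = 0) (k m : ℤ)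
    (x : E) : eichler b l y k (eichler b l y m x) = eichler b l y (k + m) x := by
  have hyl : b y l = 0 := by rw [hb, hly]
  simp only [eichler_apply, map_add, map_sub, map_smul, hl, hly, hyl]
  module

lemma eichler_isometry (hb : ∀ x y, b x y = b y x) (hl : b l l = 0) (hly : b l y = 0) (k : ℤ)
    (x z : E) : b (eichler b l y k x) (eichler b l y k z) = b x z := by
  have hyl : b y l = 0 := by rw [hb, hly]
  simp only [eichler_apply, map_add, map_sub, map_smul, LinearMap.add_apply, LinearMap.sub_apply,
    LinearMap.smul_apply, smul_eq_mul, hl, hly, hyl, hb l z, hb y z]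
  ring

lemma eichler_orthogonal {x : E} (hl : b x l = 0) (hy : b x y = 0) (k : ℤ) :
    eichler b l y k x = x := by
  rw [eichler_apply, hl, hy]; module

lemma apply_eichler (k : ℤ) (x v : E) :
    b (eichler b l y k x) v = b x v + k * (2 * (b x l * b y v - b x y * b l v))
      + k ^ 2 * (2 * b y y * (-b x l) * b l v) := by
  simp only [eichler_apply, map_add, map_sub, map_smul, LinearMap.add_apply, LinearMap.sub_apply,
    LinearMap.smul_apply, smul_eq_mul]
  ring

variable {α : S → E}

/-- A parabolic subgroup fixing a point at infinity of the chamber and moving the chamber along a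
free direction contains no finite-index subgroup preserving the roots. -/
theorem not_forall_eichler_root [Finite S] (h : IsSimpleSystem b α)
    (hl : b l l = 0) (hly : b l y = 0) (hy : 0 < b y y)
    (hα : ∀ s, (b l (α s) = 0 ∧ b y (α s) = 0) ∨ 0 < b l (α s)) (s₀ : S) (hs₀ : 0 < b l (α s₀))
    {p z : E} (hp : InChamber b α p) (hpl : b p l < 0)
    (hz : ∀ s, 0 ≤ b z (α s)) (hzs₀ : b z (α s₀) = 0) (hzl : b z l = 0) (hzy : 0 < b z y)
    {K : ℕ} (hK : 0 < K)
    (hroot : ∀ j : ℕ, ∀ s, ∃ β, IsRoot b α β ∧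
      ∀ x, b (eichler b l y ((K * j : ℕ) : ℤ) x) (α s) = b x β) : False := by
  have hgrow : ∀ s, ∃ k₀ : ℕ, ∀ k : ℤ, k₀ ≤ k → 0 < b (eichler b l y k p) (α s) := by
    intro s
    have hps := hp s
    rcases hα s with ⟨h1, h2⟩ | h1
    · refine ⟨0, fun k _ => ?_⟩
      rw [apply_eichler, h1, h2]
      linarith
    · refine ⟨(2 * (b p l * b y (α s) - b p y * b l (α s))).natAbs, fun k hk => ?_⟩
      rw [apply_eichler]
      have hlead : 1 ≤ 2 * b y y * (-b p l) * b l (α s) := by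
        have : 0 < 2 * b y y * (-b p l) * b l (α s) :=
          mul_pos (mul_pos (by omega) (by omega)) h1
        omega
      generalize 2 * b y y * (-b p l) * b l (α s) = A at *
      generalize 2 * (b p l * b y (α s) - b p y * b l (α s)) = B at *
      have h0 : 0 ≤ k := by omega
      have h2 : 0 ≤ k + B := by omega
      nlinarith [mul_nonneg h0 h2, mul_nonneg (sq_nonneg k) (sub_nonneg.2 hlead)]
  choose k₀ hk₀ using hgrow
  obtain ⟨m, hm⟩ := Set.Finite.bddAbove (Set.finite_range k₀)
  have hm' : ∀ s, k₀ s ≤ m := fun s => hm ⟨s, rfl⟩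
  set k : ℕ := K * (m + 1) with hk
  have hmk : m + 1 ≤ k := Nat.le_mul_of_pos_left _ hK
  have hch : ∀ j : ℤ, (k : ℤ) ≤ j → InChamber b α (eichler b l y j p) := fun j hj s =>
    hk₀ s j (by have := hm' s; omega)
  obtain ⟨β, hβ, hβx⟩ := hroot (m + 1) s₀
  rw [← hk] at hβx
  have hpos : IsPositive b α β := by
    refine (hβ.isPositive_or_neg h).resolve_right fun hneg => ?_
    have h1 := hneg _ (hch k le_rfl)
    rw [map_neg, ← hβx, eichler_eichler h.symm hl hly] at h1
    have h2 := hch (k + k) (by omega) s₀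
    omega
  have hpβ := hpos p hp
  have hzβ : b z β ≤ -1 := by
    have h1 : b z β = -(k * (2 * (b z y * b l (α s₀)))) := by
      rw [← hβx, apply_eichler, hzl, hzs₀]; ring
    have h2 : (0 : ℤ) < k * (2 * (b z y * b l (α s₀))) :=
      mul_pos (by omega) (mul_pos two_pos (mul_pos hzy hs₀))
    omega
  have hkey : 0 < b (p + b p β • z) β := hpos _ fun s => by
    have h1 := hp s
    have h2 := mul_nonneg hpβ.le (hz s)
    simp only [map_add, map_smul, LinearMap.add_apply, LinearMap.smul_apply, smul_eq_mul]
    omega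
  simp only [map_add, map_smul, LinearMap.add_apply, LinearMap.smul_apply, smul_eq_mul] at hkey
  nlinarith

end Eichler

/-! ### The ambient Lorentzian lattice -/

section Lorentz

/-- The lattice `ℤu ⊕ ⨁ ℤεᵢ`, with `i` running through `Fin (k + 2)`. -/
abbrev Lor (k : ℕ) : Type := ℤ × (Fin (k + 2) → ℤ)

variable {k : ℕ}

/-- The Lorentzian form with `u² = -1` and `εᵢ² = 1`. -/
def lorForm (k : ℕ) : LinearMap.BilinForm ℤ (Lor k) :=
  LinearMap.mk₂ ℤ (fun x y => -(x.1 * y.1) + x.2 ⬝ᵥ y.2)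
    (fun x y z => by simp only [Prod.fst_add, Prod.snd_add, add_dotProduct]; ring)
    (fun c x y => by simp only [Prod.smul_fst, Prod.smul_snd, smul_dotProduct, smul_eq_mul]; ring)
    (fun x y z => by simp only [Prod.fst_add, Prod.snd_add, dotProduct_add]; ring)
    (fun c x y => by simp only [Prod.smul_fst, Prod.smul_snd, dotProduct_smul, smul_eq_mul]; ring)

lemma lorForm_apply (x y : Lor k) : lorForm k x y = -(x.1 * y.1) + x.2 ⬝ᵥ y.2 := rfl

lemma lorForm_symm (x y : Lor k) : lorForm k x y = lorForm k y x := by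
  rw [lorForm_apply, lorForm_apply, dotProduct_comm, mul_comm]

/-- The vector `εᵢ - εⱼ`. -/
def diffVec (i j : Fin (k + 2)) : Lor k := (0, Pi.single i 1 - Pi.single j 1)

/-- The vector `2u + 2εᵢ + εⱼ - εₗ`. -/
def triVec (i j l : Fin (k + 2)) : Lor k :=
  (2, (2 : ℤ) • Pi.single i 1 + Pi.single j 1 - Pi.single l 1)

@[simp]
lemma diffVec_fst (i j : Fin (k + 2)) : (diffVec i j).1 = 0 := rfl

lemma diffVec_snd (i j m : Fin (k + 2)) :
    (diffVec i j).2 m = (if m = i then 1 else 0) - (if m = j then 1 else 0) := by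
  simp only [diffVec, Pi.sub_apply, Pi.single_apply]

@[simp]
lemma triVec_fst (i j l : Fin (k + 2)) : (triVec i j l).1 = 2 := rfl

lemma triVec_snd (i j l m : Fin (k + 2)) :
    (triVec i j l).2 m
      = 2 * (if m = i then 1 else 0) + (if m = j then 1 else 0) - (if m = l then 1 else 0) := by
  simp only [triVec, Pi.sub_apply, Pi.add_apply, Pi.smul_apply, Pi.single_apply, smul_eq_mul]

@[simp]
lemma lorForm_diffVec (x : Lor k) (i j : Fin (k + 2)) :
    lorForm k x (diffVec i j) = x.2 i - x.2 j := by
  simp [lorForm_apply, diffVec]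

@[simp]
lemma lorForm_triVec (x : Lor k) (i j l : Fin (k + 2)) :
    lorForm k x (triVec i j l) = -2 * x.1 + 2 * x.2 i + x.2 j - x.2 l := by
  simp only [lorForm_apply, triVec, dotProduct_add, dotProduct_sub, dotProduct_smul,
    dotProduct_single, smul_eq_mul]
  ring

/-- The index `k` of `Fin (k + 2)`. -/
def penult (k : ℕ) : Fin (k + 2) := (Fin.last k).castSucc

@[simp]
lemma penult_val : (penult k : ℕ) = k := rfl

/-- The simple roots: `εᵢ - εᵢ₊₂`, and two further ones. -/
def simpleRoot (k : ℕ) : Fin k ⊕ Bool → Lor k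
  | .inl i => diffVec (i.castAdd 2) (i.addNat 2)
  | .inr false => -triVec 0 1 (penult k)
  | .inr true => -triVec 1 0 (Fin.last (k + 1))

lemma isSimpleSystem_simpleRoot (hk : 4 ≤ k) :
    IsSimpleSystem (lorForm k) (simpleRoot k) where
  symm := lorForm_symm
  norm := by
    rintro (i | _ | _) <;>
    simp only [simpleRoot, map_neg, LinearMap.neg_apply, lorForm_diffVec, lorForm_triVec,
      diffVec_snd, triVec_fst, triVec_snd, Fin.ext_iff, Fin.val_zero, Fin.val_one, Fin.val_last,
      Fin.val_castAdd, Fin.val_addNat, penult_val, if_true] <;>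
    grind
  nonpos := by
    rintro (i | _ | _) (j | _ | _) hij <;>
    simp only [simpleRoot, map_neg, LinearMap.neg_apply, lorForm_diffVec, lorForm_triVec,
      diffVec_fst, diffVec_snd, triVec_fst, triVec_snd, Fin.ext_iff, Fin.val_zero, Fin.val_one,
      Fin.val_last, Fin.val_castAdd, Fin.val_addNat, penult_val, ne_eq, Sum.inl.injEq,
      not_true_eq_false] at hij ⊢ <;>
    grind

/-- The roots of the simple system `simpleRoot`. -/
abbrev LorRoot (k : ℕ) (v : Lor k) : Prop := IsRoot (lorForm k) (simpleRoot k) v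

/-- The action of a permutation of the `εᵢ`. -/
def permAct (σ : Equiv.Perm (Fin (k + 2))) : Lor k ≃ₗ[ℤ] Lor k :=
  (LinearEquiv.refl ℤ ℤ).prodCongr (LinearEquiv.funCongrLeft ℤ ℤ σ.symm)

lemma permAct_apply (σ : Equiv.Perm (Fin (k + 2))) (x : Lor k) :
    permAct σ x = (x.1, x.2 ∘ σ.symm) := rfl

lemma lorForm_permAct (σ : Equiv.Perm (Fin (k + 2))) (x y : Lor k) :
    lorForm k (permAct σ x) (permAct σ y) = lorForm k x y := by
  simp only [lorForm_apply, permAct_apply, comp_equiv_dotProduct_comp_equiv]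

lemma permAct_diffVec (σ : Equiv.Perm (Fin (k + 2))) (i j : Fin (k + 2)) :
    permAct σ (diffVec i j) = diffVec (σ i) (σ j) := by
  ext m
  · rfl
  · simp [permAct_apply, diffVec, Pi.single_apply, Equiv.symm_apply_eq]

lemma permAct_triVec (σ : Equiv.Perm (Fin (k + 2))) (i j l : Fin (k + 2)) :
    permAct σ (triVec i j l) = triVec (σ i) (σ j) (σ l) := by
  ext m
  · rfl
  · simp [permAct_apply, triVec, Pi.single_apply, Equiv.symm_apply_eq]

lemma rootReflection_diffVec (i j : Fin (k + 2)) (x : Lor k) :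
    rootReflection (lorForm k) (diffVec i j) x = permAct (Equiv.swap i j) x := by
  ext m
  · simp [permAct_apply, diffVec]
  · simp only [rootReflection_apply, lorForm_diffVec, permAct_apply, diffVec_snd, Prod.snd_sub,
      Prod.smul_snd, Pi.sub_apply, Pi.smul_apply, Equiv.symm_swap,
      Function.comp_apply, Equiv.swap_apply_def, smul_eq_mul]
    grind

lemma lorRoot_diffVec_of_lt (d : ℕ) : ∀ i j : Fin (k + 2), (j : ℕ) = i + 2 * (d + 1) →
    LorRoot k (diffVec i j) := by
  induction d with
  | zero =>
    intro i j hij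
    have hi : (i : ℕ) < k := by omega
    obtain rfl : j = Fin.addNat ⟨i, hi⟩ 2 := Fin.ext (by simpa using hij)
    exact IsRoot.simple (b := lorForm k) (α := simpleRoot k) (.inl ⟨i, hi⟩)
  | succ d ih =>
    intro i j hij
    have hl : (i : ℕ) + 2 * (d + 1) < k := by omega
    have h1 := ih i ⟨i + 2 * (d + 1), by omega⟩ rfl
    convert IsRoot.reflect (b := lorForm k) (α := simpleRoot k) (.inl ⟨_, hl⟩) _ h1 using 1
    rw [simpleRoot, rootReflection_diffVec, permAct_diffVec]
    congr 1
    · rw [Equiv.swap_apply_of_ne_of_ne] <;> simp [Fin.ext_iff] <;> omega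
    · rw [show (⟨i + 2 * (d + 1), by omega⟩ : Fin (k + 2)) = Fin.castAdd 2 ⟨_, hl⟩ from rfl,
        Equiv.swap_apply_left]
      exact Fin.ext (by simp; omega)

lemma lorRoot_diffVec (hk : 4 ≤ k) {i j : Fin (k + 2)} (hij : i ≠ j)
    (hpar : (i : ℕ) % 2 = j % 2) : LorRoot k (diffVec i j) := by
  have hij' : (i : ℕ) ≠ j := fun h => hij (Fin.ext h)
  rcases lt_or_gt_of_ne hij' with hlt | hlt
  · exact lorRoot_diffVec_of_lt ((j - i) / 2 - 1) i j (by omega)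
  · have := (lorRoot_diffVec_of_lt ((i - j) / 2 - 1) j i (by omega)).neg
      (isSimpleSystem_simpleRoot hk)
    convert this using 1
    ext <;> simp [diffVec]

lemma lorRoot_permAct_swap (hk : 4 ≤ k) {i j : Fin (k + 2)} (hpar : (i : ℕ) % 2 = j % 2)
    {v : Lor k} (hv : LorRoot k v) : LorRoot k (permAct (Equiv.swap i j) v) := by
  by_cases hij : i = j
  · subst hij
    rwa [Equiv.swap_self]
  · rw [← rootReflection_diffVec]
    exact (lorRoot_diffVec hk hij hpar).rootReflection (isSimpleSystem_simpleRoot hk) hv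

/-- Moving the indices of `triVec` within their parity classes. -/
lemma lorRoot_triVec_of_parity (hk : 4 ≤ k) {i₀ j₀ l₀ i j l : Fin (k + 2)}
    (h : LorRoot k (triVec i₀ j₀ l₀)) (hl₀ : i₀ ≠ l₀) (hil : i ≠ l)
    (hi : (i₀ : ℕ) % 2 = i % 2) (hj : (j₀ : ℕ) % 2 = j % 2) (hl : (i : ℕ) % 2 = l % 2)
    (hl' : (i₀ : ℕ) % 2 = l₀ % 2) (hij : (i : ℕ) % 2 ≠ j % 2) :
    LorRoot k (triVec i j l) := by
  have hne : ∀ {a c : Fin (k + 2)}, (a : ℕ) % 2 ≠ c % 2 → a ≠ c := by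
    rintro a c h rfl; exact h rfl
  have h1 := lorRoot_permAct_swap hk hi h
  rw [permAct_triVec, Equiv.swap_apply_left,
    Equiv.swap_apply_of_ne_of_ne (hne (by omega)) (hne (by omega))] at h1
  obtain ⟨l₁, hl₁, hl₁i, hl₁p⟩ : ∃ l₁, Equiv.swap i₀ i l₀ = l₁ ∧ i ≠ l₁ ∧ (l₁ : ℕ) % 2 = i % 2 := by
    refine ⟨_, rfl, ?_, ?_⟩
    · rw [ne_comm, Ne, Equiv.swap_apply_eq_iff, Equiv.swap_apply_right]
      exact hl₀.symm
    · rw [Equiv.swap_apply_def]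
      grind
  rw [hl₁] at h1
  have h2 := lorRoot_permAct_swap hk (i := l₁) (j := l) (by omega) h1
  rw [permAct_triVec, Equiv.swap_apply_left, Equiv.swap_apply_of_ne_of_ne hl₁i hil,
    Equiv.swap_apply_of_ne_of_ne (hne (by omega)) (hne (by omega))] at h2
  have h3 := lorRoot_permAct_swap hk hj h2
  rwa [permAct_triVec, Equiv.swap_apply_left,
    Equiv.swap_apply_of_ne_of_ne (hne (by omega)) (hne (by omega)),
    Equiv.swap_apply_of_ne_of_ne (hne (by omega)) (hne (by omega))] at h3

lemma lorRoot_triVec (hk : 4 ≤ k) (heven : Even k) {i j l : Fin (k + 2)} (hil : i ≠ l)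
    (hl : (i : ℕ) % 2 = l % 2) (hij : (i : ℕ) % 2 ≠ j % 2) : LorRoot k (triVec i j l) := by
  have hS := isSimpleSystem_simpleRoot hk
  have hk2 := Nat.even_iff.1 heven
  have h0 : LorRoot k (triVec 0 1 (penult k)) := by
    simpa [simpleRoot] using (IsRoot.simple (α := simpleRoot k) (.inr false)).neg hS
  have h1 : LorRoot k (triVec 1 0 (Fin.last (k + 1))) := by
    simpa [simpleRoot] using (IsRoot.simple (α := simpleRoot k) (.inr true)).neg hS
  have hone : ((1 : Fin (k + 2)) : ℕ) = 1 := rfl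
  have hzero : ((0 : Fin (k + 2)) : ℕ) = 0 := rfl
  have hpen : (penult k : ℕ) = k := rfl
  have hlast : ((Fin.last (k + 1) : Fin (k + 2)) : ℕ) = k + 1 := rfl
  rcases Nat.mod_two_eq_zero_or_one i with hi | hi
  · exact lorRoot_triVec_of_parity hk h0 (by rw [Ne, Fin.ext_iff]; omega) hil (by omega)
      (by omega) hl (by omega) hij
  · exact lorRoot_triVec_of_parity hk h1 (by rw [Ne, Fin.ext_iff]; omega) hil (by omega)
      (by omega) hl (by omega) hij

/-- A permutation compatible with the parity classes preserves the roots. -/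
lemma lorRoot_permAct (hk : 4 ≤ k) (heven : Even k) (σ : Equiv.Perm (Fin (k + 2)))
    (hσ : ∀ i, (σ i : ℕ) % 2 = (i + 1) % 2) {v : Lor k} (hv : LorRoot k v) :
    LorRoot k (permAct σ v) := by
  have hk2 := Nat.even_iff.1 heven
  have hS := isSimpleSystem_simpleRoot hk
  have hone : ((1 : Fin (k + 2)) : ℕ) = 1 := rfl
  have hzero : ((0 : Fin (k + 2)) : ℕ) = 0 := rfl
  have hpen : (penult k : ℕ) = k := rfl
  have hlast : ((Fin.last (k + 1) : Fin (k + 2)) : ℕ) = k + 1 := rfl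
  refine hv.map hS (permAct σ).toLinearMap (lorForm_permAct σ) ?_
  rintro (i | _ | _)
  · simp only [simpleRoot, LinearEquiv.coe_coe, permAct_diffVec]
    refine lorRoot_diffVec hk (σ.injective.ne ?_) ?_
    · simp [Fin.ext_iff]
    · rw [hσ, hσ]; simp; omega
  · simp only [simpleRoot, LinearEquiv.coe_coe, map_neg, permAct_triVec]
    refine (lorRoot_triVec hk heven (σ.injective.ne ?_) ?_ ?_).neg hS
    · rw [Ne, Fin.ext_iff]; omega
    · rw [hσ, hσ]; omega
    · rw [hσ, hσ]; omega
  · simp only [simpleRoot, LinearEquiv.coe_coe, map_neg, permAct_triVec]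
    refine (lorRoot_triVec hk heven (σ.injective.ne ?_) ?_ ?_).neg hS
    · rw [Ne, Fin.ext_iff]; omega
    · rw [hσ, hσ]; omega
    · rw [hσ, hσ]; omega

/-- The timelike vector `2u + ε₀ + ε₁`. -/
def cartanVec (k : ℕ) : Lor k := (2, Pi.single 0 1 + Pi.single 1 1)

lemma cartanVec_fst : (cartanVec k).1 = 2 := rfl

lemma cartanVec_snd (m : Fin (k + 2)) :
    (cartanVec k).2 m = (if m = 0 then 1 else 0) + (if m = 1 then 1 else 0) := by
  simp only [cartanVec, Pi.add_apply, Pi.single_apply]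

lemma lorForm_cartanVec (x : Lor k) :
    lorForm k x (cartanVec k) = -2 * x.1 + x.2 0 + x.2 1 := by
  simp [lorForm_apply, cartanVec]
  ring

lemma lorForm_cartanVec_self : lorForm k (cartanVec k) (cartanVec k) = -2 := by
  rw [lorForm_cartanVec]
  simp [cartanVec]

/-- The Cartan involution `x ↦ x + ⟨x, v⟩ v` with `v = 2u + ε₀ + ε₁`. -/
def cartanAct (k : ℕ) : Lor k ≃ₗ[ℤ] Lor k :=
  LinearEquiv.ofInvolutive
    (LinearMap.id + ((lorForm k).flip (cartanVec k)).smulRight (cartanVec k)) fun x => by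
      have h := lorForm_cartanVec_self (k := k)
      simp only [LinearMap.add_apply, LinearMap.id_apply, LinearMap.smulRight_apply,
        LinearMap.BilinForm.flip_apply, map_add, map_smul, h]
      module

lemma cartanAct_apply (x : Lor k) :
    cartanAct k x = x + lorForm k x (cartanVec k) • cartanVec k := rfl

lemma lorForm_cartanAct (x y : Lor k) :
    lorForm k (cartanAct k x) (cartanAct k y) = lorForm k x y := by
  simp only [cartanAct_apply, map_add, map_smul, LinearMap.add_apply, LinearMap.smul_apply,
    smul_eq_mul, lorForm_cartanVec_self, lorForm_symm (cartanVec k) y]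
  ring

lemma lorRoot_cartanAct (hk : 4 ≤ k) (heven : Even k) {v : Lor k} (hv : LorRoot k v) :
    LorRoot k (cartanAct k v) := by
  have hk2 := Nat.even_iff.1 heven
  have hS := isSimpleSystem_simpleRoot hk
  have hone : ((1 : Fin (k + 2)) : ℕ) = 1 := rfl
  have hzero : ((0 : Fin (k + 2)) : ℕ) = 0 := rfl
  have hpen : (penult k : ℕ) = k := rfl
  have hlast : ((Fin.last (k + 1) : Fin (k + 2)) : ℕ) = k + 1 := rfl
  refine hv.map hS (cartanAct k).toLinearMap lorForm_cartanAct ?_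
  rintro (i | _ | _)
  · have hval : lorForm k (simpleRoot k (.inl i)) (cartanVec k)
        = if (i : ℕ) ≤ 1 then 1 else 0 := by
      rw [lorForm_cartanVec]
      simp only [simpleRoot, diffVec_fst, diffVec_snd, Fin.ext_iff, hone, hzero,
        Fin.val_castAdd, Fin.val_addNat]
      grind
    rw [LinearEquiv.coe_coe, cartanAct_apply, hval]
    by_cases hi : (i : ℕ) ≤ 1
    · obtain ⟨j, hj1, hj2⟩ : ∃ j : Fin (k + 2), (j : ℕ) ≤ 1 ∧ (j : ℕ) % 2 ≠ (i : ℕ) % 2 :=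
        ⟨⟨1 - i, by omega⟩, by simp, by simp; omega⟩
      have hroot : LorRoot k (triVec (i.castAdd 2) j (i.addNat 2)) :=
        lorRoot_triVec hk heven (by simp [Fin.ext_iff]) (by simp) (by simp; omega)
      convert hroot using 1
      rw [if_pos hi, one_smul]
      ext m
      · simp [simpleRoot, diffVec, triVec, cartanVec]
      · simp only [simpleRoot, diffVec, triVec, cartanVec, Prod.snd_add, Pi.add_apply,
          Pi.sub_apply, Pi.single_apply, Pi.smul_apply, Fin.ext_iff, hone, hzero,
          Fin.val_castAdd, Fin.val_addNat, smul_eq_mul]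
        grind
    · rw [if_neg hi, zero_smul, add_zero]
      exact .simple _
  · have hroot : LorRoot k (diffVec (penult k) 0) :=
      lorRoot_diffVec hk (by rw [Ne, Fin.ext_iff]; omega) (by omega)
    convert hroot using 1
    rw [LinearEquiv.coe_coe, cartanAct_apply, lorForm_cartanVec]
    ext m <;>
    simp only [simpleRoot, diffVec_fst, diffVec_snd, triVec_fst, triVec_snd, cartanVec,
      Prod.fst_add, Prod.snd_add, Prod.fst_neg, Prod.snd_neg, Prod.smul_fst, Prod.smul_snd,
      Pi.neg_apply, Pi.add_apply, Pi.smul_apply, smul_eq_mul, Pi.single_apply, Fin.ext_iff,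
      hpen, hzero, hone] <;>
    grind
  · have hroot : LorRoot k (diffVec (Fin.last (k + 1)) 1) :=
      lorRoot_diffVec hk (by rw [Ne, Fin.ext_iff]; omega) (by omega)
    convert hroot using 1
    rw [LinearEquiv.coe_coe, cartanAct_apply, lorForm_cartanVec]
    ext m <;>
    simp only [simpleRoot, diffVec_fst, diffVec_snd, triVec_fst, triVec_snd, cartanVec,
      Prod.fst_add, Prod.snd_add, Prod.fst_neg, Prod.snd_neg, Prod.smul_fst, Prod.smul_snd,
      Pi.neg_apply, Pi.add_apply, Pi.smul_apply, smul_eq_mul, Pi.single_apply, Fin.ext_iff,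
      hlast, hzero, hone] <;>
    grind

/-- The alternating vector `∑ (-1)ⁱ εᵢ`. -/
def altVec (k : ℕ) : Lor k := (0, fun i => (-1) ^ (i : ℕ))

/-- The vector `u + ∑ εᵢ`. -/
def sumVec (k : ℕ) : Lor k := (1, fun _ => 1)

lemma lorForm_altVec_root (heven : Even k) {v : Lor k} (hv : LorRoot k v) :
    lorForm k (altVec k) v = 0 := by
  have hs : ∀ s, lorForm k (altVec k) (simpleRoot k s) = 0 := by
    rintro (i | _ | _)
    · simp [simpleRoot, altVec, pow_add]
    · simp [simpleRoot, altVec, heven.neg_one_pow]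
    · simp [simpleRoot, altVec, heven.neg_one_pow, pow_succ]
  induction hv with
  | simple s => exact hs s
  | reflect s x _ ih =>
    rw [rootReflection_apply, map_sub, map_smul, ih, hs, smul_zero, sub_zero]

lemma lorForm_sumVec_root {v : Lor k} (hv : LorRoot k v) : lorForm k (sumVec k) v = 0 := by
  have hs : ∀ s, lorForm k (sumVec k) (simpleRoot k s) = 0 := by
    rintro (i | _ | _) <;> simp [simpleRoot, sumVec]
  induction hv with
  | simple s => exact hs s
  | reflect s x _ ih =>
    rw [rootReflection_apply, map_sub, map_smul, ih, hs, smul_zero, sub_zero]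

end Lorentz

/-! ### A unipotent isometry lying outside the reflection group, together with its powers -/

section Unipotent

variable {k : ℕ}

lemma lorForm_altVec_sumVec (heven : Even k) : lorForm k (altVec k) (sumVec k) = 0 := by
  simp only [lorForm_apply, altVec, sumVec, dotProduct, mul_one, neg_zero, zero_add]
  rw [Fin.sum_univ_eq_sum_range (fun i => (-1 : ℤ) ^ i), neg_one_geom_sum, if_pos]
  exact heven.add even_two

lemma lorForm_altVec_self : lorForm k (altVec k) (altVec k) = k + 2 := by
  simp [lorForm_apply, altVec, dotProduct, ← mul_pow]

lemma lorForm_sumVec_self : lorForm k (sumVec k) (sumVec k) = k + 1 := by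
  simp [lorForm_apply, sumVec, dotProduct]
  ring

/-- The isotropic vector `2u + ε₀ + ε₁ + ε₂ - εₖ`. -/
def isoVec (k : ℕ) : Lor k :=
  (2, Pi.single 0 1 + Pi.single 1 1 + Pi.single 2 1 - Pi.single (penult k) 1)

/-- A vector orthogonal to `isoVec`, `altVec` and `sumVec`. -/
def transVec (k : ℕ) : Lor k :=
  (2 : ℤ) • (sumVec k - altVec k) +
    (-2, (k / 2 : ℤ) • (Pi.single 0 1 + Pi.single 2 1)
      - (4 * (k / 2 + 1) : ℤ) • Pi.single 1 1 - (2 * (k / 2) : ℤ) • Pi.single (penult k) 1)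

lemma lorForm_isoVec (x : Lor k) :
    lorForm k x (isoVec k) = -2 * x.1 + x.2 0 + x.2 1 + x.2 2 - x.2 (penult k) := by
  simp only [lorForm_apply, isoVec, dotProduct_add, dotProduct_sub, dotProduct_single]
  ring

lemma lorForm_transVec (x : Lor k) :
    lorForm k x (transVec k) = 2 * (lorForm k x (sumVec k) - lorForm k x (altVec k))
      + (2 * x.1 + (k / 2) * (x.2 0 + x.2 2) - 4 * (k / 2 + 1) * x.2 1
        - 2 * (k / 2) * x.2 (penult k)) := by
  rw [transVec, map_add, map_smul, map_sub, smul_eq_mul, add_right_inj]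
  simp only [lorForm_apply, dotProduct_add, dotProduct_sub, dotProduct_single, dotProduct_smul,
    smul_eq_mul]
  ring

lemma fin_two_val (hk : 4 ≤ k) : ((2 : Fin (k + 2)) : ℕ) = 2 :=
  Nat.mod_eq_of_lt (show 2 < k + 2 by omega)

lemma lorForm_altVec_isoVec (hk : 4 ≤ k) (heven : Even k) :
    lorForm k (altVec k) (isoVec k) = 0 := by
  rw [lorForm_isoVec]
  simp only [altVec, fin_two_val hk, penult_val, heven.neg_one_pow, Fin.val_zero, Fin.val_one]
  norm_num

lemma lorForm_sumVec_isoVec : lorForm k (sumVec k) (isoVec k) = 0 := by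
  rw [lorForm_isoVec]
  simp [sumVec]

lemma lorForm_altVec_transVec (hk : 4 ≤ k) (heven : Even k) :
    lorForm k (altVec k) (transVec k) = 0 := by
  rw [lorForm_transVec, lorForm_altVec_sumVec heven, lorForm_altVec_self]
  simp only [altVec, fin_two_val hk, penult_val, heven.neg_one_pow, Fin.val_zero, Fin.val_one]
  have := Nat.even_iff.1 heven
  norm_num
  omega

lemma lorForm_sumVec_transVec (heven : Even k) :
    lorForm k (sumVec k) (transVec k) = 0 := by
  rw [lorForm_transVec, lorForm_symm _ (altVec k), lorForm_altVec_sumVec heven,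
    lorForm_sumVec_self]
  simp only [sumVec]
  have := Nat.even_iff.1 heven
  omega

lemma isoVec_snd (m : Fin (k + 2)) :
    (isoVec k).2 m = (if m = 0 then 1 else 0) + (if m = 1 then 1 else 0)
      + (if m = 2 then 1 else 0) - (if m = penult k then 1 else 0) := by
  simp only [isoVec, Pi.sub_apply, Pi.add_apply, Pi.single_apply]

lemma lorForm_isoVec_self (hk : 4 ≤ k) : lorForm k (isoVec k) (isoVec k) = 0 := by
  rw [lorForm_isoVec]
  simp only [isoVec_snd, Fin.ext_iff, fin_two_val hk, Fin.val_zero, Fin.val_one, penult_val]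
  simp only [isoVec]
  grind

lemma lorForm_isoVec_transVec (hk : 4 ≤ k) (heven : Even k) :
    lorForm k (isoVec k) (transVec k) = 0 := by
  have := Nat.even_iff.1 heven
  rw [lorForm_transVec, lorForm_symm _ (altVec k), lorForm_symm _ (sumVec k),
    lorForm_altVec_isoVec hk heven, lorForm_sumVec_isoVec]
  simp only [isoVec_snd, Fin.ext_iff, fin_two_val hk, Fin.val_zero, Fin.val_one, penult_val]
  simp only [isoVec]
  grind

lemma transVec_fst : (transVec k).1 = 0 := by
  simp [transVec, sumVec, altVec]

lemma transVec_snd (m : Fin (k + 2)) :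
    (transVec k).2 m = 2 * (1 - (-1) ^ (m : ℕ)) + ((k / 2) * ((if m = 0 then 1 else 0)
      + (if m = 2 then 1 else 0)) - 4 * (k / 2 + 1) * (if m = 1 then 1 else 0)
      - 2 * (k / 2) * (if m = penult k then 1 else 0)) := by
  simp only [transVec, sumVec, altVec, Prod.snd_add, Prod.smul_snd, Prod.snd_sub, Pi.sub_apply,
    Pi.add_apply, Pi.smul_apply, Pi.single_apply, smul_eq_mul]

lemma lorForm_transVec_self_pos (hk : 4 ≤ k) (heven : Even k) :
    0 < lorForm k (transVec k) (transVec k) := by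
  rw [lorForm_transVec, lorForm_symm _ (altVec k), lorForm_symm _ (sumVec k),
    lorForm_altVec_transVec hk heven, lorForm_sumVec_transVec heven, transVec_fst]
  simp only [transVec_snd, Fin.ext_iff, fin_two_val hk, Fin.val_zero, Fin.val_one, penult_val,
    heven.neg_one_pow]
  have h2 : (2 : ℤ) ≤ k / 2 := by omega
  rw [if_neg (show ¬ (0 = k) by omega), if_neg (show ¬ (1 = k) by omega),
    if_neg (show ¬ (2 = k) by omega), if_neg (show ¬ (k = 0) by omega),
    if_neg (show ¬ (k = 1) by omega), if_neg (show ¬ (k = 2) by omega)]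
  norm_num
  nlinarith

/-- No positive power of the Eichler transformation attached to `isoVec` and `transVec`
normalizes the root system, even up to the radical of the pairing with the roots. -/
theorem not_forall_eichler_lorRoot (hk : 4 ≤ k) (heven : Even k) {K : ℕ} (hK : 0 < K)
    (hroot : ∀ j : ℕ, ∀ s, ∃ β, LorRoot k β ∧ ∀ x,
      lorForm k (eichler (lorForm k) (isoVec k) (transVec k) ((K * j : ℕ) : ℤ) x) (simpleRoot k s)
        = lorForm k x β) : False := by
  have hk2 := Nat.even_iff.1 heven
  have hlα : ∀ s, lorForm k (isoVec k) (simpleRoot k s)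
      = lorForm k (simpleRoot k s) (isoVec k) := fun s => lorForm_symm _ _
  have hyα : ∀ s, lorForm k (transVec k) (simpleRoot k s)
      = 2 * (simpleRoot k s).1 + (k / 2) * ((simpleRoot k s).2 0 + (simpleRoot k s).2 2)
        - 4 * (k / 2 + 1) * (simpleRoot k s).2 1 - 2 * (k / 2) * (simpleRoot k s).2 (penult k) := by
    intro s
    rw [lorForm_symm, lorForm_transVec, lorForm_symm _ (altVec k), lorForm_symm _ (sumVec k),
      lorForm_altVec_root heven (.simple s), lorForm_sumVec_root (.simple s)]
    ring
  refine not_forall_eichler_root (isSimpleSystem_simpleRoot hk) (lorForm_isoVec_self hk)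
    (lorForm_isoVec_transVec hk heven) (lorForm_transVec_self_pos hk heven) ?_
    (.inl ⟨1, by omega⟩) ?_ (p := (k + 2, fun i => -(i : ℕ)))
    (z := (1, Pi.single (penult k) (-2))) ?_ ?_ ?_ ?_ ?_ ?_ hK hroot
  · intro s
    rw [hyα, hlα, lorForm_isoVec]
    obtain i | _ | _ := s <;>
    simp only [simpleRoot, diffVec_fst, diffVec_snd, triVec_fst, triVec_snd, Fin.ext_iff,
      fin_two_val hk, Fin.val_zero, Fin.val_one, penult_val, Fin.val_castAdd, Fin.val_addNat,
      Fin.val_last, Prod.fst_neg, Prod.snd_neg, Pi.neg_apply] <;>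
    grind
  · rw [hlα, lorForm_isoVec]
    simp only [simpleRoot, diffVec_fst, diffVec_snd, Fin.ext_iff,
      fin_two_val hk, Fin.val_zero, Fin.val_one, penult_val, Fin.val_castAdd, Fin.val_addNat]
    grind
  · rintro (i | _ | _)
    · simp [simpleRoot]
    · simp [simpleRoot]
      omega
    · simp [simpleRoot]
      omega
  · rw [lorForm_isoVec]
    simp only [fin_two_val hk, Fin.val_zero, Fin.val_one, penult_val]
    omega
  · rintro (i | _ | _) <;>
    simp only [simpleRoot, map_neg, lorForm_diffVec, lorForm_triVec, Pi.single_apply, Fin.ext_iff,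
      Fin.val_zero, Fin.val_one, penult_val, Fin.val_castAdd,
      Fin.val_addNat, Fin.val_last] <;>
    grind
  · simp only [simpleRoot, lorForm_diffVec, Pi.single_apply, Fin.ext_iff,
      penult_val, Fin.val_castAdd, Fin.val_addNat]
    grind
  · rw [lorForm_isoVec]
    simp only [Pi.single_apply, Fin.ext_iff, fin_two_val hk, Fin.val_zero,
      Fin.val_one, penult_val]
    grind
  · have hsum : lorForm k (1, Pi.single (penult k) (-2)) (sumVec k) = -3 := by
      simp [lorForm_apply, sumVec, single_dotProduct]
    have halt : lorForm k (1, Pi.single (penult k) (-2)) (altVec k) = -2 := by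
      simp [lorForm_apply, altVec, single_dotProduct, heven.neg_one_pow]
    rw [lorForm_transVec, hsum, halt]
    simp only [Pi.single_apply, Fin.ext_iff, fin_two_val hk, Fin.val_zero,
      Fin.val_one, penult_val]
    grind

end Unipotent

/-! ### The quotient lattice and the companion matrices -/

section Quotient

variable {k : ℕ}

/-- The projection of the Lorentzian lattice along `altVec` and `sumVec`. -/
def lorProj (k : ℕ) : Lor k →ₗ[ℤ] (Fin (k + 1) → ℤ) where
  toFun x j := x.2 j.succ + (-1) ^ (j : ℕ) * x.2 0 - (1 + (-1) ^ (j : ℕ)) * x.1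
  map_add' x y := by
    ext j
    simp only [Prod.fst_add, Prod.snd_add, Pi.add_apply]
    ring
  map_smul' c x := by
    ext j
    simp only [Prod.smul_fst, Prod.smul_snd, Pi.smul_apply, smul_eq_mul, RingHom.id_apply]
    ring

lemma lorProj_apply (x : Lor k) (j : Fin (k + 1)) :
    lorProj k x j = x.2 j.succ + (-1) ^ (j : ℕ) * x.2 0 - (1 + (-1) ^ (j : ℕ)) * x.1 := rfl

/-- A section of `lorProj`. -/
def lorSec (k : ℕ) : (Fin (k + 1) → ℤ) →ₗ[ℤ] Lor k where
  toFun z := (0, Fin.cons 0 z)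
  map_add' z w := by
    ext j
    · simp
    · cases j using Fin.cases <;> simp
  map_smul' c z := by
    ext j
    · simp
    · cases j using Fin.cases <;> simp

lemma lorSec_apply (z : Fin (k + 1) → ℤ) : lorSec k z = (0, Fin.cons 0 z) := rfl

lemma lorProj_lorSec (z : Fin (k + 1) → ℤ) : lorProj k (lorSec k z) = z := by
  ext j
  simp [lorProj_apply, lorSec_apply]

lemma lorProj_altVec : lorProj k (altVec k) = 0 := by
  ext j
  simp [lorProj_apply, altVec, pow_succ]

lemma lorProj_sumVec : lorProj k (sumVec k) = 0 := by
  ext j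
  simp [lorProj_apply, sumVec]

lemma lorSec_lorProj (x : Lor k) :
    lorSec k (lorProj k x) = x - x.2 0 • altVec k - x.1 • (sumVec k - altVec k) := by
  ext j
  · simp [lorSec_apply, sumVec, altVec]
  · cases j using Fin.cases with
    | zero => simp [lorSec_apply, sumVec, altVec]
    | succ j =>
      simp only [lorSec_apply, lorProj_apply, sumVec, altVec, Fin.cons_succ, Prod.snd_sub,
        Prod.smul_snd, Pi.sub_apply, Pi.smul_apply, smul_eq_mul, Fin.val_succ]
      ring

/-- A linear map fixing `altVec` and `sumVec` descends to the quotient. -/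
lemma lorProj_map_lorSec_lorProj (f : Lor k →ₗ[ℤ] Lor k) (ha : f (altVec k) = altVec k)
    (hc : f (sumVec k) = sumVec k) (x : Lor k) :
    lorProj k (f (lorSec k (lorProj k x))) = lorProj k (f x) := by
  simp only [lorSec_lorProj, map_sub, map_smul, ha, hc, lorProj_altVec, lorProj_sumVec]
  simp

/-- Pairings with roots factor through the quotient. -/
lemma lorForm_root_congr (heven : Even k) {x y v : Lor k} (hxy : lorProj k x = lorProj k y)
    (hv : LorRoot k v) : lorForm k x v = lorForm k y v := by
  have key : ∀ x : Lor k, lorForm k (lorSec k (lorProj k x)) v = lorForm k x v := fun x => by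
    simp only [lorSec_lorProj, map_sub, map_smul, LinearMap.sub_apply, LinearMap.smul_apply,
      lorForm_altVec_root heven hv, lorForm_sumVec_root hv]
    simp
  rw [← key x, ← key y, hxy]

lemma levelt_mulVec_zero (c : ℕ → ℤ) (z : Fin (k + 1) → ℤ) :
    (levelt (k + 1) c *ᵥ z) 0 = -c (k + 1) * z (Fin.last k) := by
  rw [mulVec, dotProduct, Fin.sum_univ_castSucc, Finset.sum_eq_zero]
  · simp [levelt]
  · intro j _
    have := j.isLt
    simp [levelt, this.ne]

lemma levelt_mulVec_succ (c : ℕ → ℤ) (z : Fin (k + 1) → ℤ) (i : Fin k) :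
    (levelt (k + 1) c *ᵥ z) i.succ = z i.castSucc - c (k - i) * z (Fin.last k) := by
  rw [mulVec, dotProduct, Fin.sum_univ_castSucc, Finset.sum_eq_single i]
  · have := i.isLt
    simp [levelt, this.ne]
    ring
  · intro j _ hj
    have := j.isLt
    have hij : (i : ℕ) ≠ j := fun h => hj (Fin.ext h.symm)
    simp [levelt, this.ne, hij]
  · simp

lemma finRotate_symm_succ (i : Fin (k + 1)) :
    (finRotate (k + 2)).symm i.succ = i.castSucc := by
  rw [Equiv.symm_apply_eq, finRotate_apply, Fin.coeSucc_eq_succ]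

lemma finRotate_symm_zero : (finRotate (k + 2)).symm 0 = Fin.last (k + 1) := by
  rw [Equiv.symm_apply_eq, finRotate_apply, Fin.last_add_one]

lemma neg_one_pow_sub (heven : Even k) {j : ℕ} (hj : j ≤ k) : (-1 : ℤ) ^ (k - j) = (-1) ^ j :=
  neg_one_pow_congr (by simp [Nat.even_sub hj, heven])

lemma lorProj_permAct_finRotate (heven : Even k) (x : Lor k) :
    lorProj k (permAct (finRotate (k + 2)) x) = levelt (k + 1) cQalt *ᵥ lorProj k x := by
  ext j
  rw [lorProj_apply]
  simp only [permAct_apply, Function.comp_apply, finRotate_symm_succ, finRotate_symm_zero]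
  cases j using Fin.cases with
  | zero =>
    rw [levelt_mulVec_zero, lorProj_apply]
    simp only [cQalt, pow_succ, heven.neg_one_pow, Fin.val_zero, Fin.val_last, Fin.castSucc_zero,
      Fin.succ_last]
    ring
  | succ j =>
    have hpow := neg_one_pow_sub heven j.isLt.le
    rw [levelt_mulVec_succ, lorProj_apply, lorProj_apply]
    simp only [cQalt, hpow, heven.neg_one_pow, Fin.val_last, Fin.val_succ, Fin.val_castSucc,
      Fin.succ_last, Fin.succ_castSucc, pow_succ]
    ring

lemma lorProj_cartanAct_permAct_finRotate (heven : Even k) (x : Lor k) :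
    lorProj k (cartanAct k (permAct (finRotate (k + 2)) x))
      = levelt (k + 1) (cP10 (k + 1)) *ᵥ lorProj k x := by
  have hval : lorForm k (permAct (finRotate (k + 2)) x) (cartanVec k)
      = lorProj k x (Fin.last k) := by
    have h1 : (1 : Fin (k + 2)) = Fin.succ 0 := rfl
    rw [lorForm_cartanVec, lorProj_apply, h1]
    simp only [permAct_apply, Function.comp_apply, finRotate_symm_succ, finRotate_symm_zero,
      Fin.val_last, heven.neg_one_pow, Fin.succ_last, Fin.castSucc_zero]
    ring
  rw [cartanAct_apply, map_add, map_smul, hval, lorProj_permAct_finRotate heven]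
  ext j
  rw [Pi.add_apply, Pi.smul_apply, lorProj_apply (cartanVec k)]
  cases j using Fin.cases with
  | zero =>
    rw [levelt_mulVec_zero, levelt_mulVec_zero]
    simp only [cartanVec_fst, cartanVec_snd, cQalt, cP10, pow_succ, heven.neg_one_pow, smul_eq_mul,
      Fin.ext_iff, Fin.val_zero, Fin.val_one, Fin.val_succ, pow_zero, if_true]
    norm_num
    ring
  | succ j =>
    have hpow := neg_one_pow_sub heven j.isLt.le
    have hne : k - (j : ℕ) ≠ k + 1 := by omega
    rw [levelt_mulVec_succ, levelt_mulVec_succ]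
    simp only [cartanVec_fst, cartanVec_snd, cQalt, cP10, pow_succ, hpow, hne, smul_eq_mul,
      Fin.ext_iff, Fin.val_zero, Fin.val_one, Fin.val_succ, if_false]
    norm_num
    ring

/-- `g` is induced by an isometry of the Lorentzian lattice preserving the roots. -/
def HasRootLift (g : (Matrix (Fin (k + 1)) (Fin (k + 1)) ℤ)ˣ) : Prop :=
  ∃ f : Lor k ≃ₗ[ℤ] Lor k, (∀ x, lorProj k (f x) = g.val *ᵥ lorProj k x) ∧
    (∀ x y, lorForm k (f x) (f y) = lorForm k x y) ∧
    (∀ v, LorRoot k v → LorRoot k (f v)) ∧ ∀ v, LorRoot k v → LorRoot k (f.symm v)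

lemma hasRootLift_of_mem_closure {s : Set (Matrix (Fin (k + 1)) (Fin (k + 1)) ℤ)ˣ}
    (hs : ∀ g ∈ s, HasRootLift g) {g : (Matrix (Fin (k + 1)) (Fin (k + 1)) ℤ)ˣ}
    (hg : g ∈ Subgroup.closure s) : HasRootLift g := by
  induction hg using Subgroup.closure_induction with
  | mem g hg => exact hs g hg
  | one => exact ⟨.refl ℤ _, by simp, by simp, by simp, by simp⟩
  | mul g h _ _ hg hh =>
    obtain ⟨f₁, hf₁, hi₁, hr₁, hs₁⟩ := hg
    obtain ⟨f₂, hf₂, hi₂, hr₂, hs₂⟩ := hh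
    refine ⟨f₂.trans f₁, fun x => ?_, fun x y => ?_, fun v hv => ?_, fun v hv => ?_⟩
    · simp [hf₁, hf₂]
    · simp [hi₁, hi₂]
    · exact hr₁ _ (hr₂ _ hv)
    · exact hs₂ _ (hs₁ _ hv)
  | inv g _ hg =>
    obtain ⟨f, hf, hi, hr, hs⟩ := hg
    refine ⟨f.symm, fun x => ?_, fun x y => ?_, hs, hr⟩
    · have h := hf (f.symm x)
      rw [f.apply_symm_apply] at h
      rw [h, mulVec_mulVec, Units.inv_mul, one_mulVec]
    · rw [← hi, f.apply_symm_apply, f.apply_symm_apply]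

lemma finRotate_parity (heven : Even k) (i : Fin (k + 2)) :
    (finRotate (k + 2) i : ℕ) % 2 = (i + 1) % 2 := by
  have := Nat.even_iff.1 heven
  cases i using Fin.lastCases with
  | last => simp; omega
  | cast i => rw [finRotate_apply, Fin.coeSucc_eq_succ]; simp

lemma finRotate_symm_parity (heven : Even k) (i : Fin (k + 2)) :
    ((finRotate (k + 2)).symm i : ℕ) % 2 = (i + 1) % 2 := by
  have := finRotate_parity heven ((finRotate (k + 2)).symm i)
  rw [Equiv.apply_symm_apply] at this
  omega

lemma hasRootLift_levelt_cQalt (hk : 4 ≤ k) (heven : Even k)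
    {g : (Matrix (Fin (k + 1)) (Fin (k + 1)) ℤ)ˣ} (hg : g.val = levelt (k + 1) cQalt) :
    HasRootLift g := by
  refine ⟨permAct (finRotate (k + 2)), fun x => ?_, lorForm_permAct _,
    fun v hv => lorRoot_permAct hk heven _ (finRotate_parity heven) hv,
    fun v hv => lorRoot_permAct hk heven _ (finRotate_symm_parity heven) hv⟩
  rw [hg, lorProj_permAct_finRotate heven]

lemma hasRootLift_levelt_cP10 (hk : 4 ≤ k) (heven : Even k)
    {g : (Matrix (Fin (k + 1)) (Fin (k + 1)) ℤ)ˣ} (hg : g.val = levelt (k + 1) (cP10 (k + 1))) :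
    HasRootLift g := by
  refine ⟨(permAct (finRotate (k + 2))).trans (cartanAct k), fun x => ?_, fun x y => ?_,
    fun v hv => lorRoot_cartanAct hk heven
      (lorRoot_permAct hk heven _ (finRotate_parity heven) hv),
    fun v hv => lorRoot_permAct hk heven _ (finRotate_symm_parity heven)
      (lorRoot_cartanAct hk heven hv)⟩
  · rw [hg, LinearEquiv.trans_apply, lorProj_cartanAct_permAct_finRotate heven]
  · rw [LinearEquiv.trans_apply, LinearEquiv.trans_apply, lorForm_cartanAct, lorForm_permAct]

end Quotient

/-! ### Invariant rational forms -/

section InvariantForm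

variable {k n : ℕ}

/-- The bilinear form on `ℤⁿ` with Gram matrix `F`. -/
def gramForm (F : Matrix (Fin n) (Fin n) ℚ) : (Fin n → ℤ) →ₗ[ℤ] (Fin n → ℤ) →ₗ[ℤ] ℚ :=
  LinearMap.mk₂ ℤ (fun z w => (fun i => (z i : ℚ)) ⬝ᵥ F *ᵥ fun i => (w i : ℚ))
    (fun z z' w => by simp only [← add_dotProduct]; congr 1; ext i; simp)
    (fun c z w => by
      rw [← smul_dotProduct]; congr 1; ext i; simp)
    (fun z w w' => by simp only [← dotProduct_add, ← mulVec_add]; congr 2; ext i; simp)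
    (fun c z w => by
      rw [← dotProduct_smul, ← mulVec_smul]; congr 2; ext i; simp)

lemma gramForm_apply (F : Matrix (Fin n) (Fin n) ℚ) (z w : Fin n → ℤ) :
    gramForm F z w = (fun i => (z i : ℚ)) ⬝ᵥ F *ᵥ fun i => (w i : ℚ) := rfl

lemma gramForm_single (F : Matrix (Fin n) (Fin n) ℚ) (i j : Fin n) :
    gramForm F (Pi.single i 1) (Pi.single j 1) = F i j := by
  have h : ∀ i : Fin n, (fun m => ((Pi.single i (1 : ℤ) : Fin n → ℤ) m : ℚ)) = Pi.single i 1 := by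
    intro i
    ext m
    by_cases hm : m = i
    · subst hm; simp
    · simp [hm]
  rw [gramForm_apply, h, h]
  simp

lemma gramForm_injective {F F' : Matrix (Fin n) (Fin n) ℚ}
    (h : ∀ z w, gramForm F z w = gramForm F' z w) : F = F' := by
  ext i j
  rw [← gramForm_single F, h, gramForm_single]

lemma gramForm_conj (F : Matrix (Fin n) (Fin n) ℚ) (g : Matrix (Fin n) (Fin n) ℤ)
    (z w : Fin n → ℤ) : gramForm ((qm g)ᵀ * F * qm g) z w = gramForm F (g *ᵥ z) (g *ᵥ w) := by
  have h : ∀ z : Fin n → ℤ, (fun i => ((g *ᵥ z) i : ℚ)) = qm g *ᵥ fun i => (z i : ℚ) := by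
    intro z
    ext i
    simp [mulVec, dotProduct, qm]
  rw [gramForm_apply, gramForm_apply, h, h, ← mulVec_mulVec, ← mulVec_mulVec,
    dotProduct_mulVec, vecMul_transpose]

/-- The integral form on the Lorentzian lattice, proportional to the given one on the orthogonal
complement of `altVec` and `sumVec` and having these two vectors in its radical. -/
def radForm (k : ℕ) : LinearMap.BilinForm ℤ (Lor k) :=
  LinearMap.mk₂ ℤ (fun x y => (k + 1) * (k + 2) * lorForm k x y
      - (k + 1) * (lorForm k x (altVec k) * lorForm k y (altVec k))
      - (k + 2) * (lorForm k x (sumVec k) * lorForm k y (sumVec k)))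
    (fun x y z => by simp only [map_add, LinearMap.add_apply]; ring)
    (fun c x y => by simp only [map_smul, LinearMap.smul_apply, smul_eq_mul]; ring)
    (fun x y z => by simp only [map_add, LinearMap.add_apply]; ring)
    (fun c x y => by simp only [map_smul, LinearMap.smul_apply, smul_eq_mul]; ring)

lemma radForm_apply (x y : Lor k) : radForm k x y = (k + 1) * (k + 2) * lorForm k x y
      - (k + 1) * (lorForm k x (altVec k) * lorForm k y (altVec k))
      - (k + 2) * (lorForm k x (sumVec k) * lorForm k y (sumVec k)) := rfl

lemma radForm_symm (x y : Lor k) : radForm k x y = radForm k y x := by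
  rw [radForm_apply, radForm_apply, lorForm_symm x y]
  ring

lemma radForm_altVec (heven : Even k) (x : Lor k) : radForm k x (altVec k) = 0 := by
  rw [radForm_apply, lorForm_altVec_self, lorForm_altVec_sumVec heven]
  ring

lemma radForm_sumVec (heven : Even k) (x : Lor k) : radForm k x (sumVec k) = 0 := by
  rw [radForm_apply, lorForm_sumVec_self, lorForm_symm (sumVec k), lorForm_altVec_sumVec heven]
  ring

lemma radForm_isometry {f : Lor k → Lor k}
    (hf : ∀ x y, lorForm k (f x) (f y) = lorForm k x y)
    (ha : f (altVec k) = altVec k ∨ f (altVec k) = -altVec k) (hc : f (sumVec k) = sumVec k)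
    (x y : Lor k) : radForm k (f x) (f y) = radForm k x y := by
  have hc' : ∀ x, lorForm k (f x) (sumVec k) = lorForm k x (sumVec k) := fun x => by
    rw [← hf x, hc]
  rw [radForm_apply, radForm_apply, hf, hc', hc']
  rcases ha with ha | ha
  · have ha' : ∀ x, lorForm k (f x) (altVec k) = lorForm k x (altVec k) := fun x => by
      rw [← hf x, ha]
    rw [ha', ha']
  · have ha' : ∀ x, lorForm k (f x) (altVec k) = -lorForm k x (altVec k) := fun x => by
      rw [← hf x, ha, map_neg, neg_neg]
    rw [ha', ha', neg_mul_neg]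

lemma permAct_finRotate_altVec (heven : Even k) :
    permAct (finRotate (k + 2)) (altVec k) = -altVec k := by
  ext j
  · simp [permAct_apply, altVec]
  · cases j using Fin.cases with
    | zero =>
      simp [permAct_apply, altVec, pow_succ, heven.neg_one_pow]
    | succ j =>
      simp only [permAct_apply, altVec, Function.comp_apply, finRotate_symm_succ, Prod.snd_neg,
        Pi.neg_apply, Fin.val_castSucc, Fin.val_succ, pow_succ]
      ring

lemma permAct_sumVec (σ : Equiv.Perm (Fin (k + 2))) : permAct σ (sumVec k) = sumVec k := rfl

lemma radForm_permAct_finRotate (heven : Even k) (x y : Lor k) :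
    radForm k (permAct (finRotate (k + 2)) x) (permAct (finRotate (k + 2)) y) = radForm k x y :=
  radForm_isometry (lorForm_permAct _) (.inr (permAct_finRotate_altVec heven))
    (permAct_sumVec _) x y

lemma lorForm_altVec_cartanVec : lorForm k (altVec k) (cartanVec k) = 0 := by
  rw [lorForm_cartanVec]
  simp [altVec]

lemma lorForm_sumVec_cartanVec : lorForm k (sumVec k) (cartanVec k) = 0 := by
  rw [lorForm_cartanVec]
  simp [sumVec]

lemma radForm_cartanAct (x y : Lor k) :
    radForm k (cartanAct k x) (cartanAct k y) = radForm k x y :=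
  radForm_isometry lorForm_cartanAct
    (.inl (by rw [cartanAct_apply, lorForm_altVec_cartanVec, zero_smul, add_zero]))
    (by rw [cartanAct_apply, lorForm_sumVec_cartanVec, zero_smul, add_zero]) x y

lemma radForm_cartanVec (x : Lor k) :
    radForm k x (cartanVec k) = (k + 1) * (k + 2) * lorForm k x (cartanVec k) := by
  rw [radForm_apply, lorForm_symm (cartanVec k) (altVec k), lorForm_symm (cartanVec k) (sumVec k),
    lorForm_altVec_cartanVec, lorForm_sumVec_cartanVec]
  ring

/-- A matrix induced by an isometry of `radForm` preserves every form proportional to it. -/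
lemma conj_eq_of_radForm {F : Matrix (Fin (k + 1)) (Fin (k + 1)) ℚ} {c : ℚ}
    (hF : ∀ x y, gramForm F (lorProj k x) (lorProj k y) = c * radForm k x y)
    {g : Matrix (Fin (k + 1)) (Fin (k + 1)) ℤ} {f : Lor k → Lor k}
    (hg : ∀ x, lorProj k (f x) = g *ᵥ lorProj k x)
    (hf : ∀ x y, radForm k (f x) (f y) = radForm k x y) : (qm g)ᵀ * F * qm g = F := by
  refine gramForm_injective fun z w => ?_
  rw [gramForm_conj, ← lorProj_lorSec z, ← lorProj_lorSec w, ← hg, ← hg, hF, hF, hf]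

/-- The matrix of `radForm` on the quotient lattice. -/
def radMatrix (k : ℕ) : Matrix (Fin (k + 1)) (Fin (k + 1)) ℚ :=
  Matrix.of fun i j => (radForm k (lorSec k (Pi.single i 1)) (lorSec k (Pi.single j 1)) : ℚ)

lemma radMatrix_isSymm : (radMatrix k).IsSymm := by
  ext i j
  simp only [radMatrix, transpose_apply, of_apply, radForm_symm (lorSec k (Pi.single i 1))]

lemma gramForm_radMatrix (heven : Even k) (x y : Lor k) :
    gramForm (radMatrix k) (lorProj k x) (lorProj k y) = radForm k x y := by
  have hsec : ∀ z w, gramForm (radMatrix k) z w = radForm k (lorSec k z) (lorSec k w) := by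
    have h : gramForm (radMatrix k) = ((radForm k).compl₁₂ (lorSec k) (lorSec k)).compr₂
        (Int.castAddHom ℚ).toIntLinearMap :=
      LinearMap.ext_basis (Pi.basisFun ℤ _) (Pi.basisFun ℤ _) fun i j => by
        simp [gramForm_single, radMatrix]
    intro z w
    rw [h]
    rfl
  have hr : ∀ x y, radForm k x (lorSec k (lorProj k y)) = radForm k x y := fun x y => by
    simp only [lorSec_lorProj, map_sub, map_smul, radForm_altVec heven, radForm_sumVec heven]
    simp
  rw [hsec, hr, radForm_symm, hr, radForm_symm]

lemma radMatrix_ne_zero (heven : Even k) : radMatrix k ≠ 0 := by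
  intro h0
  have h := gramForm_radMatrix heven (cartanVec k) (cartanVec k)
  rw [h0, gramForm_apply, zero_mulVec, dotProduct_zero, radForm_cartanVec,
    lorForm_cartanVec_self] at h
  have h' : ((k : ℤ) + 1) * (k + 2) * -2 = 0 := by exact_mod_cast h.symm
  have : (0 : ℤ) < (k + 1) * (k + 2) := by positivity
  omega

/-- The vector `2u + εᵢ + εᵢ₊₁`. -/
def edgeVec (i : Fin (k + 1)) : Lor k := (2, Pi.single i.castSucc 1 + Pi.single i.succ 1)

lemma permAct_finRotate_edgeVec (i : Fin k) :
    permAct (finRotate (k + 2)) (edgeVec i.castSucc) = edgeVec i.succ := by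
  ext m
  · rfl
  · simp only [permAct_apply, edgeVec, Function.comp_apply, Pi.add_apply, Pi.single_apply,
      Equiv.symm_apply_eq, finRotate_apply, Fin.coeSucc_eq_succ, ← Fin.castSucc_succ]

/-- The vectors `edgeVec`, `altVec` and `sumVec` span the lattice rationally. -/
lemma eq_zero_of_edgeVec (heven : Even k) (f : Lor k →ₗ[ℤ] ℚ) (hf : ∀ i, f (edgeVec i) = 0)
    (ha : f (altVec k) = 0) (hc : f (sumVec k) = 0) : f = 0 := by
  set U := f (1, 0) with hU
  set t : Fin (k + 2) → ℚ := fun i => f (0, Pi.single i 1) with ht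
  have hexp : ∀ x : Lor k, f x = x.1 * U + ∑ i, x.2 i * t i := by
    intro x
    have hx : x = x.1 • ((1, 0) : Lor k) + ∑ i, x.2 i • ((0, Pi.single i 1) : Lor k) := by
      ext j
      · simp [Prod.fst_sum]
      · simp [Prod.snd_sum, Pi.single_apply]
    conv_lhs => rw [hx]
    simp only [map_add, map_sum, map_smul]
    simp only [zsmul_eq_mul, hU, ht]
  have hstep : ∀ i : Fin (k + 1), t i.succ = -t i.castSucc - 2 * U := by
    intro i
    have h : edgeVec i = (2 : ℤ) • ((1, 0) : Lor k) + (0, Pi.single i.castSucc 1)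
        + (0, Pi.single i.succ 1) := by
      ext j <;> simp [edgeVec]
    have := hf i
    rw [h, map_add, map_add, map_smul, zsmul_eq_mul] at this
    push_cast at this
    simp only [ht, hU]
    linarith
  obtain ⟨w, hform⟩ : ∃ w, ∀ i : Fin (k + 2), t i = (-1) ^ (i : ℕ) * w - U := by
    refine ⟨t 0 + U, fun i => ?_⟩
    induction i using Fin.induction with
    | zero => simp
    | succ i ih =>
      rw [hstep, ih, Fin.val_succ, Fin.val_castSucc, pow_succ]
      ring
  have halt : ∑ i : Fin (k + 2), (-1 : ℚ) ^ (i : ℕ) = 0 := by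
    rw [Fin.sum_univ_eq_sum_range (fun i => (-1 : ℚ) ^ i), neg_one_geom_sum, if_pos]
    exact heven.add even_two
  have hsq : ∀ i : ℕ, (-1 : ℚ) ^ i * (-1) ^ i = 1 := fun i => by rw [← mul_pow]; simp
  have hUz : U = 0 := by
    rw [hexp] at hc
    simp only [sumVec, Int.cast_one, one_mul, hform, Finset.sum_sub_distrib, ← Finset.sum_mul,
      halt] at hc
    simp at hc
    have : ((k : ℚ) + 1) * U = 0 := by linarith
    exact (mul_eq_zero.1 this).resolve_left (by positivity)
  have hw : w = 0 := by
    rw [hexp] at ha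
    simp only [altVec, hform, hUz] at ha
    simp [← mul_assoc, hsq] at ha
    exact ha.resolve_left (by positivity)
  ext x <;> simp [hexp, hUz, hform, hw]

/-- Every form invariant under the two companion matrices is proportional to `radForm`. -/
theorem exists_gramForm_eq_radForm (heven : Even k) {F : Matrix (Fin (k + 1)) (Fin (k + 1)) ℚ}
    (hP : (qm (levelt (k + 1) (cP10 (k + 1))))ᵀ * F * qm (levelt (k + 1) (cP10 (k + 1))) = F)
    (hQ : (qm (levelt (k + 1) cQalt))ᵀ * F * qm (levelt (k + 1) cQalt) = F) :
    ∃ c : ℚ, ∀ x y, gramForm F (lorProj k x) (lorProj k y) = c * radForm k x y := by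
  set R := permAct (finRotate (k + 2)) with hR
  have hrot : ∀ x y, gramForm F (lorProj k (R x)) (lorProj k (R y))
      = gramForm F (lorProj k x) (lorProj k y) := fun x y => by
    rw [hR, lorProj_permAct_finRotate heven, lorProj_permAct_finRotate heven, ← gramForm_conj, hQ]
  have hcar : ∀ x y, gramForm F (lorProj k (cartanAct k x)) (lorProj k (cartanAct k y))
      = gramForm F (lorProj k x) (lorProj k y) := fun x y => by
    obtain ⟨x, rfl⟩ := R.surjective x
    obtain ⟨y, rfl⟩ := R.surjective y
    rw [hrot, hR, lorProj_cartanAct_permAct_finRotate heven,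
      lorProj_cartanAct_permAct_finRotate heven, ← gramForm_conj, hP]
  set v := cartanVec k with hv
  set N := gramForm F (lorProj k v) (lorProj k v) with hN
  have hD : ((k : ℚ) + 1) * (k + 2) ≠ 0 := by positivity
  set c : ℚ := -N / (2 * ((k + 1) * (k + 2))) with hc
  have hvx : ∀ x, gramForm F (lorProj k x) (lorProj k v) = c * radForm k x v := by
    intro x
    have h := hcar x v
    have hcv : cartanAct k v = -v := by
      rw [cartanAct_apply, ← hv, hv, lorForm_cartanVec_self]
      module
    rw [hcv, cartanAct_apply, ← hv] at h
    simp only [map_add, map_neg, map_smul, LinearMap.add_apply, LinearMap.smul_apply,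
      ← hN] at h
    rw [zsmul_eq_mul] at h
    rw [hv, radForm_cartanVec, ← hv, hc]
    push_cast
    field_simp
    linarith
  have hedge : ∀ (i : Fin (k + 1)) (x : Lor k),
      gramForm F (lorProj k x) (lorProj k (edgeVec i)) = c * radForm k x (edgeVec i) := by
    intro i
    induction i using Fin.induction with
    | zero => exact hvx
    | succ i ih =>
      intro x
      obtain ⟨x, rfl⟩ := R.surjective x
      rw [← permAct_finRotate_edgeVec, ← hR, hrot, ih, hR, radForm_permAct_finRotate heven]
  refine ⟨c, fun x y => ?_⟩
  have hzero := eq_zero_of_edgeVec heven ((gramForm F (lorProj k x)).comp (lorProj k)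
    - c • (Int.castAddHom ℚ).toIntLinearMap.comp (radForm k x)) (fun i => by
      simp [hedge]) (by simp [lorProj_altVec, radForm_altVec heven])
      (by simp [lorProj_sumVec, radForm_sumVec heven])
  have := LinearMap.congr_fun hzero y
  simp at this
  linarith

end InvariantForm

section Thin

variable {k : ℕ}

/-- The powers of the unipotent isometry attached to `isoVec` and `transVec`. -/
abbrev lorEichler (k : ℕ) (m : ℤ) : Lor k →ₗ[ℤ] Lor k :=
  eichler (lorForm k) (isoVec k) (transVec k) m

/-- The matrix induced by `lorEichler` on the quotient lattice. -/
def eichlerMatrix (k : ℕ) (m : ℤ) : Matrix (Fin (k + 1)) (Fin (k + 1)) ℤ :=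
  LinearMap.toMatrix' (lorProj k ∘ₗ lorEichler k m ∘ₗ lorSec k)

lemma lorEichler_altVec (hk : 4 ≤ k) (heven : Even k) (m : ℤ) :
    lorEichler k m (altVec k) = altVec k :=
  eichler_orthogonal (lorForm_altVec_isoVec hk heven) (lorForm_altVec_transVec hk heven) m

lemma lorEichler_sumVec (heven : Even k) (m : ℤ) : lorEichler k m (sumVec k) = sumVec k :=
  eichler_orthogonal lorForm_sumVec_isoVec (lorForm_sumVec_transVec heven) m

lemma lorProj_lorEichler (hk : 4 ≤ k) (heven : Even k) (m : ℤ) (x : Lor k) :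
    lorProj k (lorEichler k m x) = eichlerMatrix k m *ᵥ lorProj k x := by
  rw [eichlerMatrix, LinearMap.toMatrix'_mulVec]
  exact (lorProj_map_lorSec_lorProj _ (lorEichler_altVec hk heven m)
    (lorEichler_sumVec heven m) x).symm

lemma eichlerMatrix_mul (hk : 4 ≤ k) (heven : Even k) (m m' : ℤ) :
    eichlerMatrix k m * eichlerMatrix k m' = eichlerMatrix k (m + m') := by
  refine ext_of_mulVec_single fun i => ?_
  rw [← mulVec_mulVec, ← lorProj_lorSec (Pi.single i 1), ← lorProj_lorEichler hk heven,
    ← lorProj_lorEichler hk heven, ← lorProj_lorEichler hk heven,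
    eichler_eichler lorForm_symm (lorForm_isoVec_self hk) (lorForm_isoVec_transVec hk heven)]

lemma eichlerMatrix_zero (hk : 4 ≤ k) (heven : Even k) : eichlerMatrix k 0 = 1 := by
  refine ext_of_mulVec_single fun i => ?_
  rw [← lorProj_lorSec (Pi.single i 1), ← lorProj_lorEichler hk heven, eichler_zero, one_mulVec]

/-- The invertible matrix induced by the unipotent isometry. -/
def eichlerUnit (hk : 4 ≤ k) (heven : Even k) : (Matrix (Fin (k + 1)) (Fin (k + 1)) ℤ)ˣ where
  val := eichlerMatrix k 1
  inv := eichlerMatrix k (-1)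
  val_inv := by rw [eichlerMatrix_mul hk heven, add_neg_cancel, eichlerMatrix_zero hk heven]
  inv_val := by rw [eichlerMatrix_mul hk heven, neg_add_cancel, eichlerMatrix_zero hk heven]

lemma eichlerUnit_pow (hk : 4 ≤ k) (heven : Even k) (m : ℕ) :
    (eichlerUnit hk heven ^ m).val = eichlerMatrix k m := by
  induction m with
  | zero => simp [eichlerMatrix_zero hk heven]
  | succ m ih =>
    rw [pow_succ, Units.val_mul, ih, Nat.cast_succ, ← eichlerMatrix_mul hk heven]
    rfl

lemma eichlerUnit_mem_OFgrp (hk : 4 ≤ k) (heven : Even k)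
    {F : Matrix (Fin (k + 1)) (Fin (k + 1)) ℚ} {c : ℚ}
    (hF : ∀ x y, gramForm F (lorProj k x) (lorProj k y) = c * radForm k x y) :
    eichlerUnit hk heven ∈ OFgrp (k + 1) F :=
  conj_eq_of_radForm hF (lorProj_lorEichler hk heven 1)
    (radForm_isometry
      (eichler_isometry lorForm_symm (lorForm_isoVec_self hk) (lorForm_isoVec_transVec hk heven) 1)
      (.inl (lorEichler_altVec hk heven 1)) (lorEichler_sumVec heven 1))

/-- No positive power of the unipotent element lies in the monodromy group. -/
lemma eichlerUnit_pow_notMem (hk : 4 ≤ k) (heven : Even k)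
    {H : Subgroup (Matrix (Fin (k + 1)) (Fin (k + 1)) ℤ)ˣ} (hH : ∀ g ∈ H, HasRootLift g)
    {K : ℕ} (hK : 0 < K) : eichlerUnit hk heven ^ K ∉ H := by
  intro hmem
  refine not_forall_eichler_lorRoot hk heven hK fun j s => ?_
  obtain ⟨f, hf, hiso, -, hsymm⟩ := hH _ (pow_mem hmem j)
  refine ⟨f.symm (simpleRoot k s), hsymm _ (.simple s), fun x => ?_⟩
  rw [← hiso x, f.apply_symm_apply]
  refine lorForm_root_congr heven ?_ (.simple s)
  rw [hf, ← pow_mul, eichlerUnit_pow, ← lorProj_lorEichler hk heven]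

end Thin

theorem stmt14 (n : ℕ) (hn : 5 ≤ n) (hodd : Odd n) :
    (∃ F : Matrix (Fin n) (Fin n) ℚ, F ≠ 0 ∧ F.IsSymm ∧
      (qm (levelt n (cP10 n)))ᵀ * F * qm (levelt n (cP10 n)) = F ∧
      (qm (levelt n cQalt))ᵀ * F * qm (levelt n cQalt) = F) ∧
    ∀ F : Matrix (Fin n) (Fin n) ℚ, F ≠ 0 → F.IsSymm →
      (qm (levelt n (cP10 n)))ᵀ * F * qm (levelt n (cP10 n)) = F →
      (qm (levelt n cQalt))ᵀ * F * qm (levelt n cQalt) = F →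
      ∀ gA gB : (Matrix (Fin n) (Fin n) ℤ)ˣ,
        (gA : Matrix (Fin n) (Fin n) ℤ) = levelt n (cP10 n) →
        (gB : Matrix (Fin n) (Fin n) ℤ) = levelt n cQalt →
        (Subgroup.closure {gA, gB}).relIndex (OFgrp n F) = 0 := by
  obtain ⟨k, rfl⟩ : ∃ k, n = k + 1 := ⟨n - 1, by omega⟩
  have hk : 4 ≤ k := by omega
  have heven : Even k := by
    rw [Nat.odd_add_one, Nat.not_odd_iff_even] at hodd
    exact hodd
  refine ⟨⟨radMatrix k, radMatrix_ne_zero heven, radMatrix_isSymm, ?_, ?_⟩, ?_⟩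
  · exact conj_eq_of_radForm (c := 1) (fun x y => by rw [gramForm_radMatrix heven, one_mul])
      (lorProj_cartanAct_permAct_finRotate heven)
      (fun x y => by rw [radForm_cartanAct, radForm_permAct_finRotate heven])
  · exact conj_eq_of_radForm (c := 1) (fun x y => by rw [gramForm_radMatrix heven, one_mul])
      (lorProj_permAct_finRotate heven) (radForm_permAct_finRotate heven)
  · intro F _ _ hP hQ gA gB hA hB
    obtain ⟨c, hF⟩ := exists_gramForm_eq_radForm heven hP hQ
    by_contra hne
    obtain ⟨K, hK, -, hmem⟩ :=
      Subgroup.exists_pow_mem_of_relIndex_ne_zero hne (eichlerUnit_mem_OFgrp hk heven hF)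
    refine eichlerUnit_pow_notMem hk heven (fun g hg => hasRootLift_of_mem_closure ?_ hg) hK
      hmem.1
    rintro g (rfl | rfl)
    · exact hasRootLift_levelt_cP10 hk heven hA
    · exact hasRootLift_levelt_cQalt hk heven hB
end

section
/- Let n ≥ 5 be odd. Let A ∈ GL_n(ℤ) be the Levelt companion matrix of P(x) = xⁿ + xⁿ⁻¹ + x + 1 = (x+1)(x^{n−1}+1) and let B ∈ GL_n(ℤ) be the Levelt companion matrix of Q(x) = xⁿ − 2xⁿ⁻¹ + xⁿ⁻² − x² + 2x − 1 = (x−1)²(x^{n−2}−1). Then there exists a nonzero symmetric matrix F ∈ M_n(ℚ) with AᵗFA = F and BᵗFB = F, and for every such F, the subgroup of GL_n(ℤ) generated by A and B has infinite index in the group O_F(ℤ) := {g ∈ GL_n(ℤ) : gᵗFg = F}. (The group ⟨A,B⟩ is the hyperbolic hypergeometric monodromy group of the family ℳ₂(n−2,n), i.e. of α = (1/2, 1/(2n−2), 3/(2n−2), …, (2n−3)/(2n−2)), β = (0, 0, 0, 1/(n−2), …, (n−3)/(n−2)); the theorem says it is thin.) -/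
open Matrix

/-- Coefficients of `P(x) = xⁿ + xⁿ⁻¹ + x + 1 = (x+1)(x^{n-1}+1)`. -/
def cP15 (n : ℕ) : ℕ → ℤ := fun k => if k = 1 ∨ k = n - 1 ∨ k = n then 1 else 0

/-- Coefficients of `Q(x) = xⁿ - 2xⁿ⁻¹ + xⁿ⁻² - x² + 2x - 1 = (x-1)²(x^{n-2}-1)`. -/
def cQ15 (n : ℕ) : ℕ → ℤ := fun k =>
  if k = 1 then -2
  else if k = 2 then 1
  else if k = n - 2 then -1
  else if k = n - 1 then 2
  else if k = n then -1
  else 0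

/-- The lattice `ℤ^{N,1}`, with the negative coordinate first. -/
abbrev LorentzLattice (N : ℕ) : Type := ℤ × (Fin N → ℤ)

namespace LorentzLattice

section

variable {N : ℕ}

/-- The Lorentzian inner product. -/
def ip (x y : LorentzLattice N) : ℤ := x.2 ⬝ᵥ y.2 - x.1 * y.1

lemma ip_comm (x y : LorentzLattice N) : ip x y = ip y x := by
  simp [ip, dotProduct_comm x.2, mul_comm x.1]

@[simp] lemma ip_add_left (x y z : LorentzLattice N) : ip (x + y) z = ip x z + ip y z := by
  simp [ip]; ring

@[simp] lemma ip_sub_left (x y z : LorentzLattice N) : ip (x - y) z = ip x z - ip y z := by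
  simp [ip]; ring

@[simp] lemma ip_neg_left (x z : LorentzLattice N) : ip (-x) z = -ip x z := by
  simp [ip]; ring

@[simp] lemma ip_smul_left (c : ℤ) (x z : LorentzLattice N) : ip (c • x) z = c * ip x z := by
  simp only [ip, Prod.smul_fst, Prod.smul_snd, smul_dotProduct, smul_eq_mul]; ring

@[simp] lemma ip_add_right (x y z : LorentzLattice N) : ip x (y + z) = ip x y + ip x z := by
  simp [ip]; ring

@[simp] lemma ip_sub_right (x y z : LorentzLattice N) : ip x (y - z) = ip x y - ip x z := by
  simp [ip]; ring

@[simp] lemma ip_neg_right (x z : LorentzLattice N) : ip x (-z) = -ip x z := by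
  simp [ip]; ring

@[simp] lemma ip_smul_right (c : ℤ) (x z : LorentzLattice N) : ip x (c • z) = c * ip x z := by
  simp only [ip, Prod.smul_fst, Prod.smul_snd, dotProduct_smul, smul_eq_mul]; ring

/-- The base point of hyperbolic space. -/
def origin : LorentzLattice N := (1, 0)

lemma ip_origin (x : LorentzLattice N) : ip x origin = -x.1 := by simp [ip, origin]

/-- The orthogonal reflection in a vector of norm one. -/
def refl (r : LorentzLattice N) : Module.End ℤ (LorentzLattice N) where
  toFun x := x - (2 * ip x r) • r
  map_add' x y := by simp only [ip_add_left]; module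
  map_smul' c x := by simp only [ip_smul_left, RingHom.id_apply]; module

lemma refl_apply (r x : LorentzLattice N) : refl r x = x - (2 * ip x r) • r := rfl

/-- A linear map preserving the Lorentzian inner product. -/
def IsIsom (g : Module.End ℤ (LorentzLattice N)) : Prop := ∀ x y, ip (g x) (g y) = ip x y

lemma IsIsom.mul {g h : Module.End ℤ (LorentzLattice N)} (hg : IsIsom g) (hh : IsIsom h) :
    IsIsom (g * h) := fun x y => (hg _ _).trans (hh x y)

lemma isIsom_refl {r : LorentzLattice N} (hr : ip r r = 1) : IsIsom (refl r) := by
  intro x y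
  simp only [refl_apply, ip_sub_left, ip_sub_right, ip_smul_left, ip_smul_right, hr, ip_comm r y]
  ring

lemma refl_mul_self {r : LorentzLattice N} (hr : ip r r = 1) : refl r * refl r = 1 := by
  refine LinearMap.ext fun x => ?_
  simp only [Module.End.mul_apply, refl_apply, ip_sub_left, ip_smul_left, hr, Module.End.one_apply]
  module

lemma refl_comm {r q : LorentzLattice N} (h : ip r q = 0) (x : LorentzLattice N) :
    refl r (refl q x) = refl q (refl r x) := by
  simp only [refl_apply, ip_sub_left, ip_smul_left, h, ip_comm q r]
  module

lemma IsIsom.refl_apply {g : Module.End ℤ (LorentzLattice N)} (hg : IsIsom g)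
    (r x : LorentzLattice N) : g (refl r x) = refl (g r) (g x) := by
  simp only [LorentzLattice.refl_apply, map_sub, map_smul, hg x r]

/-- The roots: vectors of norm one at height one. -/
def IsRoot (r : LorentzLattice N) : Prop := ip r r = 1 ∧ r.1 = 1

/-- Forward timelike vectors off the mirrors of all roots. -/
def Good (x : LorentzLattice N) : Prop :=
  0 < x.1 ∧ ip x x < 0 ∧ ∀ r, IsRoot r → Odd (ip x r)

lemma dotProduct_sq_le (v w : Fin N → ℤ) : (v ⬝ᵥ w) ^ 2 ≤ (v ⬝ᵥ v) * (w ⬝ᵥ w) := by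
  simpa [dotProduct, sq] using Finset.sum_mul_sq_le_sq_mul_sq Finset.univ v w

lemma good_origin : Good (origin : LorentzLattice N) :=
  ⟨one_pos, by simp [ip, origin], fun r hr => by
    rw [ip_comm, ip_origin, hr.2]; decide⟩

lemma refl_fst {r : LorentzLattice N} (hr : IsRoot r) (x : LorentzLattice N) :
    (refl r x).1 = x.1 - 2 * ip x r := by
  simp [refl_apply, hr.2]

lemma Good.refl {x r : LorentzLattice N} (hx : Good x) (hr : IsRoot r) : Good (refl r x) := by
  obtain ⟨h0, hn, ho⟩ := hx
  refine ⟨?_, by rwa [isIsom_refl hr.1], fun q hq => ?_⟩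
  · rw [refl_fst hr]
    have hcs := dotProduct_sq_le x.2 r.2
    have h1 := hr.1
    have h2 := hr.2
    simp only [ip, h2] at h1 hn ⊢
    have h3 : r.2 ⬝ᵥ r.2 = 2 := by linarith
    rw [h3] at hcs
    by_contra hcon
    nlinarith
  · have := ho q hq
    simp only [refl_apply, ip_sub_left, ip_smul_left]
    rw [mul_assoc]
    exact this.sub_even (even_two_mul _)

/-- A forward timelike vector is on the positive side of two different roots only if these
are orthogonal. -/
lemma eq_or_ip_eq_zero {x r q : LorentzLattice N} (hx : Good x) (hr : IsRoot r) (hq : IsRoot q)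
    (hxr : 0 < ip x r) (hxq : 0 < ip x q) : r = q ∨ ip r q = 0 := by
  obtain ⟨h0, hn, -⟩ := hx
  obtain ⟨hr1, hr2⟩ := hr
  obtain ⟨hq1, hq2⟩ := hq
  have hcs := dotProduct_sq_le x.2 (r.2 + q.2)
  simp only [ip, hr2, hq2, dotProduct_add, add_dotProduct, dotProduct_comm q.2 r.2]
    at hn hxr hxq hr1 hq1 hcs ⊢
  have h3 : 0 ≤ (r.2 - q.2) ⬝ᵥ (r.2 - q.2) := by
    simp only [dotProduct]; exact Finset.sum_nonneg fun i _ => mul_self_nonneg _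
  have h4 : (r.2 - q.2) ⬝ᵥ (r.2 - q.2) = 4 - 2 * (r.2 ⬝ᵥ q.2) := by
    simp only [sub_dotProduct, dotProduct_sub, dotProduct_comm q.2 r.2]; linarith
  have hlow : 0 < r.2 ⬝ᵥ q.2 := by
    by_contra hcon
    have : x.2 ⬝ᵥ x.2 * (r.2 ⬝ᵥ r.2 + r.2 ⬝ᵥ q.2 + (r.2 ⬝ᵥ q.2 + q.2 ⬝ᵥ q.2)) ≤
        x.2 ⬝ᵥ x.2 * 4 :=
      mul_le_mul_of_nonneg_left (by linarith) (by
        simp only [dotProduct]; exact Finset.sum_nonneg fun i _ => mul_self_nonneg _)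
    nlinarith
  rcases (by omega : r.2 ⬝ᵥ q.2 = 1 ∨ r.2 ⬝ᵥ q.2 = 2) with h | h
  · right; linarith
  · left
    rw [h] at h4
    have h5 : r.2 - q.2 = 0 := dotProduct_self_eq_zero.mp (by linarith)
    exact Prod.ext (by rw [hr2, hq2]) (sub_eq_zero.mp h5)

open Classical in
/-- Propagation of `base` from irreducible vectors along lowering reflections. -/
noncomputable def descend {Ω : Type*} (p : LorentzLattice N → Ω → Ω) (base : LorentzLattice N → Ω)
    (x : LorentzLattice N) : Ω :=
  if h : Good x ∧ ∃ r, IsRoot r ∧ 0 < ip x r then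
    p h.2.choose (descend p base (refl h.2.choose x))
  else base x
termination_by x.1.toNat
decreasing_by
  have h1 := h.2.choose_spec
  have h2 := refl_fst h1.1 x
  have h3 := h.1.1
  omega

lemma descend_refl_of_pos {Ω : Type*} {p : LorentzLattice N → Ω → Ω} {base : LorentzLattice N → Ω}
    (hcomm : ∀ r q, IsRoot r → IsRoot q → ip r q = 0 → ∀ ω, p r (p q ω) = p q (p r ω)) (k : ℕ) :
    ∀ x : LorentzLattice N, x.1.toNat ≤ k → Good x → ∀ r, IsRoot r → 0 < ip x r →
      descend p base x = p r (descend p base (refl r x)) := by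
  induction k with
  | zero => intro x hk hx; have := hx.1; omega
  | succ k ih =>
    intro x hk hx r hr hpos
    have h : Good x ∧ ∃ r, IsRoot r ∧ 0 < ip x r := ⟨hx, r, hr, hpos⟩
    rw [descend, dif_pos h]
    generalize hqq : h.2.choose = q
    have hq := h.2.choose_spec
    rw [hqq] at hq
    have hτ := hx.1
    have hfq := refl_fst hq.1 x
    have hfr := refl_fst hr x
    rcases eq_or_ip_eq_zero hx hr hq.1 hpos hq.2 with rfl | h0
    · rfl
    · have e1 : ip (refl q x) r = ip x r := by
        simp only [refl_apply, ip_sub_left, ip_smul_left, ip_comm q r, h0, mul_zero, sub_zero]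
      have e2 : ip (refl r x) q = ip x q := by
        simp only [refl_apply, ip_sub_left, ip_smul_left, h0, mul_zero, sub_zero]
      rw [ih (refl q x) (by omega) (hx.refl hq.1) r hr (by rwa [e1]),
        ih (refl r x) (by omega) (hx.refl hr) q hq.1 (by rw [e2]; exact hq.2),
        refl_comm h0, hcomm r q hr hq.1 h0]

lemma descend_refl {Ω : Type*} {p : LorentzLattice N → Ω → Ω} {base : LorentzLattice N → Ω}
    (hinv : ∀ r, IsRoot r → ∀ ω, p r (p r ω) = ω)
    (hcomm : ∀ r q, IsRoot r → IsRoot q → ip r q = 0 → ∀ ω, p r (p q ω) = p q (p r ω))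
    {x r : LorentzLattice N} (hx : Good x) (hr : IsRoot r) :
    descend p base (refl r x) = p r (descend p base x) := by
  have hrr : refl r (refl r x) = x := LinearMap.congr_fun (refl_mul_self hr.1) x
  rcases lt_trichotomy (ip x r) 0 with h | h | h
  · have h2 : ip (refl r x) r = -ip x r := by
      simp only [refl_apply, ip_sub_left, ip_smul_left, hr.1]; ring
    rw [descend_refl_of_pos hcomm _ _ le_rfl (hx.refl hr) r hr (by omega), hrr]
  · exact absurd (hx.2.2 r hr) (by rw [h]; decide)
  · rw [descend_refl_of_pos hcomm _ _ le_rfl hx r hr h, hinv r hr]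

/-- The product of the reflections in the members of a list. -/
def reflProd (l : List (LorentzLattice N)) : Module.End ℤ (LorentzLattice N) := (l.map refl).prod

lemma good_reflProd {l : List (LorentzLattice N)} (hl : ∀ r ∈ l, IsRoot r) :
    Good (reflProd l origin) := by
  induction l with
  | nil => simpa [reflProd] using good_origin
  | cons r l ih =>
    simp only [reflProd, List.map_cons, List.prod_cons, Module.End.mul_apply]
    exact (ih fun q hq => hl q (List.mem_cons_of_mem _ hq)).refl (hl r List.mem_cons_self)

lemma descend_irreducible {Ω : Type*} {p : LorentzLattice N → Ω → Ω} {base : LorentzLattice N → Ω}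
    {x : LorentzLattice N} (h : ∀ r, IsRoot r → ip x r ≤ 0) : descend p base x = base x := by
  rw [descend, dif_neg]
  rintro ⟨-, r, hr, hpos⟩
  exact absurd (h r hr) (by omega)

lemma ip_origin_nonpos (r : LorentzLattice N) (hr : IsRoot r) : ip origin r ≤ 0 := by
  rw [ip_comm, ip_origin, hr.2]; decide

/-- Reflections acting by commuting involutions: the value at a product of reflections. -/
lemma descend_reflProd {G : Type*} [Group G] {p : LorentzLattice N → G}
    (hinv : ∀ r, IsRoot r → p r * p r = 1)
    (hcomm : ∀ r q, IsRoot r → IsRoot q → ip r q = 0 → p r * p q = p q * p r)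
    {l : List (LorentzLattice N)} (hl : ∀ r ∈ l, IsRoot r) :
    descend (fun r g => p r * g) (fun _ => 1) (reflProd l origin) = (l.map p).prod := by
  induction l with
  | nil => exact descend_irreducible ip_origin_nonpos
  | cons r l ih =>
    have hl' : ∀ q ∈ l, IsRoot q := fun q hq => hl q (List.mem_cons_of_mem _ hq)
    have hr := hl r List.mem_cons_self
    simp only [reflProd, List.map_cons, List.prod_cons, Module.End.mul_apply]
    have := descend_refl (p := fun r g => p r * g) (base := fun _ => 1)
      (fun r hr g => by rw [← mul_assoc, hinv r hr, one_mul])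
      (fun r q hr hq h g => by simp only [← mul_assoc, hcomm r q hr hq h])
      (good_reflProd hl') hr
    rw [← ih hl']
    exact this

lemma eq_origin_of_irreducible {l : List (LorentzLattice N)} (hl : ∀ r ∈ l, IsRoot r)
    (h : ∀ r, IsRoot r → ip (reflProd l origin) r ≤ 0) : reflProd l origin = origin := by
  have key : ∀ l : List (LorentzLattice N), (∀ r ∈ l, IsRoot r) →
      descend (fun _ x => x) id (reflProd l origin) = origin := by
    intro l hl
    induction l with
    | nil => exact descend_irreducible (p := fun _ x => x) (base := id) ip_origin_nonpos
    | cons r l ih =>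
      have hl' : ∀ q ∈ l, IsRoot q := fun q hq => hl q (List.mem_cons_of_mem _ hq)
      refine Eq.trans ?_ (ih hl')
      exact descend_refl (p := fun _ x => x) (fun _ _ _ => rfl) (fun _ _ _ _ _ _ => rfl)
        (good_reflProd hl') (hl r List.mem_cons_self)
  exact (descend_irreducible (p := fun _ x => x) (base := id) h).symm.trans (key l hl)

/-- The linear inequality satisfied by the orbit of the origin. -/
lemma sum_le_two_mul_fst {l : List (LorentzLattice N)} (hl : ∀ r ∈ l, IsRoot r) :
    ∑ i, (reflProd l origin).2 i ≤ 2 * (reflProd l origin).1 := by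
  obtain ⟨k, hk⟩ : ∃ k, (reflProd l origin).1.toNat ≤ k := ⟨_, le_rfl⟩
  induction k generalizing l with
  | zero => have := (good_reflProd hl).1; omega
  | succ k ih =>
    by_cases h : ∀ r, IsRoot r → ip (reflProd l origin) r ≤ 0
    · rw [eq_origin_of_irreducible hl h]; simp [origin]
    · push Not at h
      obtain ⟨r, hr, hpos⟩ := h
      have hl' : ∀ q ∈ r :: l, IsRoot q := List.forall_mem_cons.mpr ⟨hr, hl⟩
      have e : reflProd (r :: l) origin = refl r (reflProd l origin) := by simp [reflProd]
      have hτ := (good_reflProd hl).1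
      have hf := refl_fst hr (reflProd l origin)
      have := ih hl' (by rw [e]; omega)
      rw [e, hf, refl_apply] at this
      simp only [Prod.snd_sub, Prod.smul_snd, Pi.sub_apply, Pi.smul_apply, smul_eq_mul,
        Finset.sum_sub_distrib, ← Finset.mul_sum] at this
      have hq : ∑ i, r.2 i ≤ 2 := by
        have h1 := hr.1
        simp only [ip, hr.2] at h1
        calc ∑ i, r.2 i ≤ ∑ i, r.2 i * r.2 i :=
              Finset.sum_le_sum fun i _ => by nlinarith [sq_nonneg (r.2 i), Int.le_self_sq (r.2 i)]
          _ = 2 := by rw [dotProduct] at h1; linarith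
      nlinarith

end

section

variable {p : ℕ}

/-- The coordinates of a vector, continued anti-periodically. -/
def co (Z : Fin (p + 4) → ℤ) (j : ℕ) : ℤ :=
  if h : j < p + 4 then Z ⟨j, h⟩
  else if h : j - (p + 4) < p + 4 then -Z ⟨j - (p + 4), h⟩ else 0

lemma co_of_lt (Z : Fin (p + 4) → ℤ) {j : ℕ} (h : j < p + 4) : co Z j = Z ⟨j, h⟩ := dif_pos h

@[simp] lemma co_val (Z : Fin (p + 4) → ℤ) (j : Fin (p + 4)) : co Z j = Z j := co_of_lt Z j.2

lemma co_add_period (Z : Fin (p + 4) → ℤ) {j k : ℕ} (h : j < p + 4) (hk : k = j + (p + 4)) :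
    co Z k = -co Z j := by
  subst hk
  rw [co_of_lt Z h, co, dif_neg (by omega), dif_pos (by omega)]
  simp

@[simp] lemma co_add (Z W : Fin (p + 4) → ℤ) (j : ℕ) : co (Z + W) j = co Z j + co W j := by
  simp only [co]; split_ifs <;> simp; ring

@[simp] lemma co_smul (c : ℤ) (Z : Fin (p + 4) → ℤ) (j : ℕ) : co (c • Z) j = c * co Z j := by
  simp only [co]; split_ifs <;> simp

/-- Minus the anti-cyclic shift fixing the origin. -/
def shift : Module.End ℤ (LorentzLattice (p + 4)) where
  toFun x := (-x.1, fun i => if (i : ℕ) = 0 then -co x.2 (p + 3) else co x.2 (i - 1))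
  map_add' x y := by
    ext i
    · simp; ring
    · simp only [Prod.snd_add, co_add, Pi.add_apply]; split_ifs <;> ring
  map_smul' c x := by
    ext i
    · simp
    · simp only [Prod.smul_snd, co_smul, Pi.smul_apply, smul_eq_mul, RingHom.id_apply]
      split_ifs <;> ring

/-- The inverse of `shift`. -/
def shiftInv : Module.End ℤ (LorentzLattice (p + 4)) where
  toFun x := (-x.1, fun i => co x.2 (i + 1))
  map_add' x y := by
    ext i
    · simp; ring
    · simp
  map_smul' c x := by
    ext i
    · simp
    · simp only [Prod.smul_snd, co_smul, Pi.smul_apply, smul_eq_mul, RingHom.id_apply]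

@[simp] lemma shift_fst (x : LorentzLattice (p + 4)) : (shift x).1 = -x.1 := rfl

lemma co_shift_zero (x : LorentzLattice (p + 4)) : co (shift x).2 0 = -co x.2 (p + 3) := by
  rw [co_of_lt _ (by omega)]; simp [shift]

lemma co_shift_succ (x : LorentzLattice (p + 4)) {j : ℕ} (h : j < p + 3 + (p + 4)) :
    co (shift x).2 (j + 1) = co x.2 j := by
  have key : ∀ j < p + 3, co (shift x).2 (j + 1) = co x.2 j := fun j hj => by
    rw [co_of_lt _ (by omega)]; simp [shift]
  rcases lt_trichotomy j (p + 3) with h1 | rfl | h1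
  · exact key j h1
  · rw [co_add_period (shift x).2 (j := 0) (by omega) (by omega), co_shift_zero, neg_neg]
  · obtain ⟨k, rfl⟩ : ∃ k, j = k + (p + 4) := ⟨j - (p + 4), by omega⟩
    rw [co_add_period _ (j := k + 1) (by omega) (by omega),
      co_add_period _ (j := k) (by omega) rfl, key k (by omega)]

lemma ext_co {x y : LorentzLattice (p + 4)} (h1 : x.1 = y.1)
    (h2 : ∀ j < p + 4, co x.2 j = co y.2 j) : x = y :=
  Prod.ext h1 (funext fun i => by simpa using h2 i i.2)

lemma shift_mul_shiftInv : (shift * shiftInv : Module.End ℤ (LorentzLattice (p + 4))) = 1 := by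
  refine LinearMap.ext fun x => ext_co (by simp [shift, shiftInv]) fun j hj => ?_
  have key : ∀ j < p + 4, co (shiftInv x).2 j = co x.2 (j + 1) := fun j hj => by
    rw [co_of_lt _ hj]; simp [shiftInv]
  simp only [Module.End.mul_apply, Module.End.one_apply]
  rcases j with _ | j
  · rw [co_shift_zero, key _ (by omega), co_add_period _ (j := 0) (by omega) (by omega), neg_neg]
  · rw [co_shift_succ _ (by omega), key _ (by omega)]

lemma shiftInv_mul_shift : (shiftInv * shift : Module.End ℤ (LorentzLattice (p + 4))) = 1 := by
  refine LinearMap.ext fun x => ext_co (by simp [shift, shiftInv]) fun j hj => ?_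
  have key : ∀ y : LorentzLattice (p + 4), ∀ j < p + 4,
      co (shiftInv y).2 j = co y.2 (j + 1) := fun y j hj => by
    rw [co_of_lt _ hj]; simp [shiftInv]
  simp only [Module.End.mul_apply, Module.End.one_apply]
  rw [key _ _ hj, co_shift_succ _ (by omega)]

lemma isIsom_shift : IsIsom (shift : Module.End ℤ (LorentzLattice (p + 4))) := by
  intro x y
  simp only [ip, shift_fst, dotProduct]
  rw [Fin.sum_univ_succ, Fin.sum_univ_castSucc (fun i => x.2 i * y.2 i)]
  have h0 : ∀ x : LorentzLattice (p + 4), (shift x).2 0 = -x.2 (Fin.last _) := fun x => by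
    have := co_shift_zero x
    rwa [co_of_lt _ (by omega), co_of_lt _ (by omega)] at this
  have hs : ∀ (x : LorentzLattice (p + 4)) (i : Fin (p + 3)),
      (shift x).2 i.succ = x.2 i.castSucc := fun x i => by
    rw [← co_val (shift x).2, ← co_val x.2, Fin.val_succ, co_shift_succ _ (by omega)]; rfl
  simp only [h0, hs]
  ring

/-- The norm `-2` vector of the pseudo-reflection. -/
def vneg : LorentzLattice (p + 4) := (2, Pi.single 1 1 - Pi.single 0 1)

/-- The root whose mirror is that of the pseudo-reflection, up to a symmetry of the origin. -/
def root0 : LorentzLattice (p + 4) := (1, Pi.single 1 1 - Pi.single 0 1)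

lemma ip_vneg (x : LorentzLattice (p + 4)) : ip x vneg = -2 * x.1 - co x.2 0 + co x.2 1 := by
  rw [co_of_lt _ (by omega), co_of_lt _ (by omega)]
  simp only [ip, vneg, dotProduct_sub, dotProduct_single, mul_one]
  have : (⟨1, by omega⟩ : Fin (p + 4)) = 1 := rfl
  rw [this, Fin.mk_zero]; ring

lemma ip_root0 (x : LorentzLattice (p + 4)) : ip x root0 = -x.1 - x.2 0 + x.2 1 := by
  simp only [ip, root0, dotProduct_sub, dotProduct_single, mul_one]
  ring

lemma isRoot_root0 : IsRoot (root0 : LorentzLattice (p + 4)) :=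
  ⟨by rw [ip_root0]; simp [root0], rfl⟩

lemma ip_vneg_self : ip (vneg : LorentzLattice (p + 4)) vneg = -2 := by
  rw [ip_vneg, co_of_lt _ (by omega), co_of_lt _ (by omega)]
  have : (⟨1, by omega⟩ : Fin (p + 4)) = 1 := rfl
  rw [this]; simp [vneg]

/-- The reflection in `vneg`. -/
def flip : Module.End ℤ (LorentzLattice (p + 4)) where
  toFun x := x + ip x vneg • vneg
  map_add' x y := by simp only [ip_add_left]; module
  map_smul' c x := by simp only [ip_smul_left, RingHom.id_apply]; module

lemma flip_apply (x : LorentzLattice (p + 4)) : flip x = x + ip x vneg • vneg := rfl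

lemma flip_mul_flip : (flip * flip : Module.End ℤ (LorentzLattice (p + 4))) = 1 := by
  refine LinearMap.ext fun x => ?_
  simp only [Module.End.mul_apply, flip_apply, ip_add_left, ip_smul_left, ip_vneg_self,
    Module.End.one_apply]
  module

lemma isIsom_flip : IsIsom (flip : Module.End ℤ (LorentzLattice (p + 4))) := by
  intro x y
  simp only [flip_apply, ip_add_left, ip_add_right, ip_smul_left, ip_smul_right, ip_vneg_self,
    ip_comm vneg y]
  ring

/-- The embedding of the Lorentzian lattice intertwining the two actions. -/
def emb : LorentzLattice (p + 4) →ₗ[ℤ] (Fin (p + 5) → ℤ) where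
  toFun x i :=
    if (i : ℕ) = p + 4 then -2 * x.1 - co x.2 0 + co x.2 1
    else if (i : ℕ) = 0 then co x.2 1 - co x.2 2 - 2 * x.1
    else co x.2 i - co x.2 (i + 2)
  map_add' x y := by
    ext i
    simp only [Prod.snd_add, Prod.fst_add, co_add, Pi.add_apply]; split_ifs <;> ring
  map_smul' c x := by
    ext i
    simp only [Prod.smul_snd, Prod.smul_fst, co_smul, Pi.smul_apply, smul_eq_mul,
      RingHom.id_apply]
    split_ifs <;> ring

lemma emb_apply (x : LorentzLattice (p + 4)) (i : Fin (p + 5)) : emb x i =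
    if (i : ℕ) = p + 4 then -2 * x.1 - co x.2 0 + co x.2 1
    else if (i : ℕ) = 0 then co x.2 1 - co x.2 2 - 2 * x.1
    else co x.2 i - co x.2 (i + 2) := rfl

lemma emb_last (x : LorentzLattice (p + 4)) : emb x (Fin.last _) = ip x vneg := by
  simp [emb_apply, ip_vneg]

lemma _root_.levelt_mulVec {m : ℕ} (c : ℕ → ℤ) (y : Fin (m + 1) → ℤ) (i : Fin (m + 1)) :
    (levelt (m + 1) c *ᵥ y) i =
      (Fin.cons 0 (fun k : Fin m => y k.castSucc) : Fin (m + 1) → ℤ) i -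
        c (m + 1 - i) * y (Fin.last m) := by
  simp only [mulVec, dotProduct, levelt, of_apply]
  rw [Fin.sum_univ_castSucc]
  have h1 : ∀ j : Fin m, (if ((j.castSucc : Fin (m + 1)) : ℕ) = m + 1 - 1 then -c (m + 1 - i)
      else if (i : ℕ) = (j.castSucc : ℕ) + 1 then (1 : ℤ) else 0) =
      if i = j.succ then 1 else 0 := fun j => by
    rw [if_neg (by simp; omega)]; simp [Fin.ext_iff]
  simp only [h1]
  refine Fin.cases ?_ (fun k => ?_) i
  · simp [Fin.ext_iff]
  · simp [sub_eq_add_neg]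

lemma levelt_cP15_emb (x : LorentzLattice (p + 4)) :
    levelt (p + 5) (cP15 (p + 5)) *ᵥ emb x = emb (shift x) := by
  ext i
  rw [levelt_mulVec, emb_last, ip_vneg, emb_apply]
  refine Fin.cases ?_ (fun k => ?_) i
  · simp only [Fin.cons_zero, Fin.val_zero, cP15, shift_fst]
    rw [co_shift_succ x (j := 0) (by omega), co_shift_succ x (j := 1) (by omega)]
    simp; ring
  · simp only [Fin.cons_succ, Fin.val_succ, shift_fst, co_shift_zero, emb_apply, Fin.val_castSucc]
    rw [co_shift_succ x (j := 0) (by omega), co_shift_succ x (j := k) (by omega),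
      show (k : ℕ) + 1 + 2 = k + 2 + 1 by omega, co_shift_succ x (j := k + 2) (by omega)]
    have hk := k.2
    rw [if_neg (by omega)]
    rcases Nat.eq_zero_or_pos k with h | h
    · simp [h, cP15]; ring
    · by_cases h' : (k : ℕ) = p + 3
      · have := co_add_period x.2 (j := 1) (k := p + 3 + 2) (by omega) (by omega)
        simp [h', cP15, this]; ring
      · simp only [cP15]
        rw [if_neg (by omega), if_neg (by omega), if_neg (by omega), if_neg (by omega)]
        ring

lemma levelt_cQ15_emb (x : LorentzLattice (p + 4)) :
    levelt (p + 5) (cQ15 (p + 5)) *ᵥ emb x = emb (shift (flip x)) := by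
  have hv : ∀ i : Fin (p + 5), emb (shift vneg) i =
      cP15 (p + 5) (p + 5 - i) - cQ15 (p + 5) (p + 5 - i) := by
    have h0 : co (vneg : LorentzLattice (p + 4)).2 0 = -1 := by
      rw [co_of_lt _ (by omega)]; simp [vneg]
    have h1 : co (vneg : LorentzLattice (p + 4)).2 1 = 1 := by
      rw [co_of_lt _ (by omega)]
      have : (⟨1, by omega⟩ : Fin (p + 4)) = 1 := rfl
      rw [this]; simp [vneg]
    have h2 : ∀ j, 2 ≤ j → j < p + 4 → co (vneg : LorentzLattice (p + 4)).2 j = 0 := by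
      intro j hj hj'
      rw [co_of_lt _ hj']
      simp [vneg, Pi.single_apply, Fin.ext_iff]
      rw [if_neg (by omega), if_neg (by omega), sub_zero]
    have h3 : co (vneg : LorentzLattice (p + 4)).2 (p + 4) = 1 := by
      rw [co_add_period _ (j := 0) (by omega) (by omega), h0, neg_neg]
    have hτ : (vneg : LorentzLattice (p + 4)).1 = 2 := rfl
    intro i
    rw [emb_apply]
    refine Fin.cases ?_ (fun k => ?_) i
    · simp only [Fin.val_zero, shift_fst]
      rw [co_shift_succ _ (j := 0) (by omega), co_shift_succ _ (j := 1) (by omega)]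
      simp [cP15, cQ15, h0, h1, hτ]
    · have hk := k.2
      simp only [Fin.val_succ, shift_fst, co_shift_zero]
      rw [co_shift_succ _ (j := 0) (by omega), co_shift_succ _ (j := k) (by omega),
        show (k : ℕ) + 1 + 2 = k + 2 + 1 by omega, co_shift_succ _ (j := k + 2) (by omega)]
      rcases (by omega : (k : ℕ) = 0 ∨ (k : ℕ) = 1 ∨ (k : ℕ) = p + 3 ∨ (k : ℕ) = p + 2 ∧ 2 ≤ (k : ℕ)
        ∨ 2 ≤ (k : ℕ) ∧ (k : ℕ) < p + 2) with h | h | h | ⟨h, h'⟩ | ⟨h, h'⟩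
      · simp [h, cP15, cQ15, h0, h2]
      · simp [h, cP15, cQ15, h1, h2]
      · simp [h, cP15, cQ15, h0, h2, hτ]
      · simp [h, cP15, cQ15, h2, h3]
      · rw [h2 k h (by omega), h2 (k + 2) (by omega) (by omega)]
        simp only [cP15, cQ15]
        rw [if_neg (by omega), if_neg (by omega), if_neg (by omega), if_neg (by omega),
          if_neg (by omega), if_neg (by omega), if_neg (by omega), if_neg (by omega)]
  have hflip : emb (shift (flip x)) = emb (shift x) + ip x vneg • emb (shift vneg) := by
    rw [flip_apply, map_add, map_smul, map_add, map_smul]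
  rw [hflip, ← levelt_cP15_emb]
  ext i
  rw [Pi.add_apply, Pi.smul_apply, hv, levelt_mulVec, levelt_mulVec, emb_last, smul_eq_mul]
  ring

lemma emb_injective (hp : Even p) : Function.Injective (emb : LorentzLattice (p + 4) →ₗ[ℤ] _) := by
  rw [injective_iff_map_eq_zero]
  intro x hx
  have hx' : ∀ i : Fin (p + 5), emb x i = 0 := fun i => congrFun hx i
  have hstep : ∀ j, 1 ≤ j → j < p + 4 → co x.2 (j + 2) = co x.2 j := by
    intro j h1 h2
    have := hx' ⟨j, by omega⟩
    rw [emb_apply] at this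
    simp only at this
    rw [if_neg (by omega), if_neg (by omega)] at this
    linarith
  have ha := hx' 0
  have hb := hx' (Fin.last _)
  rw [emb_apply] at ha hb
  simp only [Fin.val_zero, Fin.val_last, if_true] at ha hb
  rw [if_neg (by omega)] at ha
  obtain ⟨q, rfl⟩ := hp
  have hodd : ∀ k, 2 * k + 1 ≤ q + q + 5 → co x.2 (2 * k + 1) = co x.2 1 := by
    intro k
    induction k with
    | zero => intro _; rfl
    | succ k ih =>
      intro hk
      rw [← ih (by omega), ← hstep (2 * k + 1) (by omega) (by omega)]; congr 1
  have heven : ∀ k, 2 * k + 2 ≤ q + q + 5 → co x.2 (2 * k + 2) = co x.2 2 := by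
    intro k
    induction k with
    | zero => intro _; rfl
    | succ k ih =>
      intro hk
      rw [← ih (by omega), ← hstep (2 * k + 2) (by omega) (by omega)]; congr 1
  have h1 := hodd (q + 2) (by omega)
  have h2 := heven (q + 1) (by omega)
  rw [co_add_period _ (j := 1) (by omega) (by omega)] at h1
  rw [co_add_period _ (j := 0) (by omega) (by omega)] at h2
  have hz : ∀ j, co (0 : Fin (q + q + 4) → ℤ) j = 0 := fun j => by simp [co]
  refine ext_co (by simp; linarith) fun j hj => ?_
  rw [show (0 : LorentzLattice (q + q + 4)).2 = 0 from rfl, hz]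
  rcases Nat.even_or_odd' j with ⟨k, rfl | rfl⟩
  · rcases k with _ | k
    · simp; linarith
    · rw [show 2 * (k + 1) = 2 * k + 2 by ring, heven k (by omega)]; linarith
  · rw [hodd k (by omega)]; linarith

/-- A preimage of four times the first basis vector. -/
def cyc : LorentzLattice (p + 4) :=
  (-1, fun i => if (i : ℕ) = 0 then 2 else if (i : ℕ) % 2 = 0 then -2 else 0)

lemma emb_cyc (hp : Even p) : emb (cyc : LorentzLattice (p + 4)) = Pi.single 0 4 := by
  have h : ∀ j < p + 4, co (cyc : LorentzLattice (p + 4)).2 j =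
      if j = 0 then 2 else if j % 2 = 0 then -2 else 0 := fun j hj => by
    rw [co_of_lt _ hj]; rfl
  have hN := co_add_period (cyc : LorentzLattice (p + 4)).2 (j := 0) (k := p + 2 + 2)
    (by omega) (by omega)
  have hN1 := co_add_period (cyc : LorentzLattice (p + 4)).2 (j := 1) (k := p + 3 + 2)
    (by omega) (by omega)
  rw [h 0 (by omega)] at hN
  rw [h 1 (by omega)] at hN1
  have hτ : (cyc : LorentzLattice (p + 4)).1 = -1 := rfl
  ext i
  rw [emb_apply, hτ, h 0 (by omega), h 1 (by omega), h 2 (by omega)]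
  have hi := i.2
  rw [Nat.even_iff] at hp
  rcases (by omega : (i : ℕ) = 0 ∨ (i : ℕ) = p + 4 ∨ (i : ℕ) = p + 3 ∨ (i : ℕ) = p + 2 ∨
    1 ≤ (i : ℕ) ∧ (i : ℕ) < p + 2) with hc | hc | hc | hc | ⟨hc, hc'⟩
  · simp [hc, Pi.single_apply, Fin.ext_iff]
  · simp [hc, Fin.ext_iff]
  · rw [h i (by omega)]
    rw [hc, hN1]
    simp [hc, Fin.ext_iff]; omega
  · rw [h i (by omega)]
    rw [hc, hN]
    simp [hc, Fin.ext_iff]; omega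
  · rw [h i (by omega), h (i + 2) (by omega)]
    simp only [Pi.single_apply, Fin.ext_iff, Fin.val_zero]
    split_ifs <;> first | omega | rfl | contradiction

lemma exists_emb_eq (hp : Even p) (i : Fin (p + 5)) :
    ∃ x : LorentzLattice (p + 4), emb x = Pi.single i 4 := by
  induction i using Fin.induction with
  | zero => exact ⟨cyc, emb_cyc hp⟩
  | succ i ih =>
    obtain ⟨x, hx⟩ := ih
    refine ⟨shift x, ?_⟩
    rw [← levelt_cP15_emb, hx]
    ext j
    rw [levelt_mulVec]
    have : (Pi.single i.castSucc 4 : Fin (p + 5) → ℤ) (Fin.last (p + 4)) = 0 :=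
      Pi.single_eq_of_ne (by simp [Fin.ext_iff]; omega) _
    rw [this]
    refine Fin.cases ?_ (fun k => ?_) j
    · rw [Pi.single_eq_of_ne (Fin.succ_ne_zero i).symm]; simp
    · simp only [Fin.cons_succ, Pi.single_apply, Fin.castSucc_inj, Fin.succ_inj, mul_zero, sub_zero]

/-- `emb` is invertible up to a factor four. -/
lemma exists_quasi_inverse (hp : Even p) :
    ∃ Φ : (Fin (p + 5) → ℤ) →ₗ[ℤ] LorentzLattice (p + 4),
      (∀ y, emb (Φ y) = (4 : ℤ) • y) ∧ ∀ x, Φ (emb x) = (4 : ℤ) • x := by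
  choose f hf using exists_emb_eq hp
  have key : ∀ y, emb ((Pi.basisFun ℤ (Fin (p + 5))).constr ℤ f y) = (4 : ℤ) • y := by
    intro y
    rw [Module.Basis.constr_apply_fintype, map_sum]
    simp only [map_smul, hf]
    ext j
    simp [Finset.sum_apply, Pi.single_apply, mul_comm]
  refine ⟨(Pi.basisFun ℤ (Fin (p + 5))).constr ℤ f, key, fun x => emb_injective hp ?_⟩
  rw [key, map_smul]

end

section

variable {p : ℕ}

lemma shift_origin : shift (origin : LorentzLattice (p + 4)) = -origin :=
  ext_co (by simp [origin]) fun j hj => by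
    rcases j with _ | j
    · rw [co_shift_zero, co_of_lt _ (by omega), co_of_lt _ (by omega)]; simp [origin]
    · rw [co_shift_succ _ (by omega), co_of_lt _ (by omega), co_of_lt _ (by omega)]
      simp [origin]

/-- A saturated sublattice which contains `vneg` and is stable under `shift` is everything. -/
lemma eq_top_of_vneg_mem (hp : Even p) (S : Submodule ℤ (LorentzLattice (p + 4)))
    (hsat : ∀ x, (2 : ℤ) • x ∈ S → x ∈ S) (hshift : ∀ x ∈ S, shift x ∈ S) (hv : vneg ∈ S) :
    S = ⊤ := by
  have hpow : ∀ x ∈ S, ∀ k : ℕ, (shift ^ k) x ∈ S := by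
    intro x hx k
    induction k with
    | zero => simpa using hx
    | succ k ih => rw [pow_succ', Module.End.mul_apply]; exact hshift _ ih
  let E : ℕ → LorentzLattice (p + 4) := fun k => (shift ^ k) (0, Pi.single 0 1)
  have hEsucc : ∀ k, E (k + 1) = shift (E k) := fun k => by
    simp only [E]; rw [pow_succ', Module.End.mul_apply]
  have hE : ∀ k (hk : k < p + 4), E k = (0, Pi.single ⟨k, hk⟩ 1) := by
    intro k
    induction k with
    | zero => intro hk; simp [E]
    | succ k ih =>
      intro hk
      rw [hEsucc, ih (by omega)]
      refine ext_co (by simp) fun j hj => ?_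
      rcases j with _ | j
      · rw [co_shift_zero, co_of_lt _ (by omega), co_of_lt _ (by omega)]
        simp [Pi.single_apply, Fin.ext_iff]
        omega
      · rw [co_shift_succ _ (by omega), co_of_lt _ (by omega), co_of_lt _ (by omega)]
        simp [Pi.single_apply, Fin.ext_iff]
  have hEN : E (p + 4) = -E 0 := by
    rw [hEsucc (p + 3), hE _ (by omega), hE 0 (by omega)]
    refine ext_co (by simp) fun j hj => ?_
    rcases j with _ | j
    · rw [co_shift_zero, co_of_lt _ (by omega), co_of_lt _ (by omega)]
      simp
    · rw [co_shift_succ _ (by omega), co_of_lt _ (by omega), co_of_lt _ (by omega)]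
      simp [Pi.single_apply, Fin.ext_iff]
      omega
  have hEN1 : E (p + 4 + 1) = -E 1 := by rw [hEsucc, hEN, map_neg, ← hEsucc]
  have ho : ∀ k : ℕ, (shift ^ k) (origin : LorentzLattice (p + 4)) = (-1 : ℤ) ^ k • origin := by
    intro k
    induction k with
    | zero => simp
    | succ k ih =>
      rw [pow_succ', Module.End.mul_apply, ih, map_smul, shift_origin, pow_succ]
      module
  have hve : vneg = (2 : ℤ) • (origin : LorentzLattice (p + 4)) + (E 1 - E 0) := by
    rw [hE 0 (by omega), hE 1 (by omega)]
    have : (⟨1, by omega⟩ : Fin (p + 4)) = 1 := rfl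
    rw [this, Fin.mk_zero]
    ext i <;> simp [vneg, origin]
  have hEk : ∀ k j, (shift ^ k) (E j) = E (k + j) := fun k j => by
    simp only [E]; rw [pow_add, Module.End.mul_apply]
  have hvk : ∀ k, (shift ^ k) vneg = (2 * (-1) ^ k : ℤ) • (origin : LorentzLattice (p + 4)) +
      (E (k + 1) - E k) := fun k => by
    rw [hve, map_add, map_sub, map_smul, ho, hEk, hEk, smul_smul]; rfl
  have hoS : (origin : LorentzLattice (p + 4)) ∈ S := by
    refine hsat _ (hsat _ ?_)
    have h1 := S.add_mem hv (hpow _ hv (p + 4))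
    rw [hvk, hEN, hEN1, hve, Even.neg_one_pow (by simpa [parity_simps] using hp)] at h1
    convert h1 using 1
    module
  have hdiff : ∀ k, E (k + 1) - E k ∈ S := fun k => by
    have h1 := S.sub_mem (hpow _ hv k) (S.smul_mem (2 * (-1) ^ k : ℤ) hoS)
    rwa [hvk, add_sub_cancel_left] at h1
  have hdiff0 : ∀ k, E k - E 0 ∈ S := fun k => by
    induction k with
    | zero => simp
    | succ k ih => simpa using S.add_mem (hdiff k) ih
  have hE0 : E 0 ∈ S := by
    refine hsat _ ?_
    have h1 := S.neg_mem (hdiff0 (p + 4))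
    rw [hEN] at h1
    convert h1 using 1
    module
  have hES : ∀ k, E k ∈ S := fun k => by simpa using S.add_mem (hdiff0 k) hE0
  refine eq_top_iff.mpr fun x _ => ?_
  have hx : x = x.1 • origin + ∑ i : Fin (p + 4), x.2 i • E i := by
    have : ∀ i : Fin (p + 4), E i = (0, Pi.single i 1) := fun i => hE i i.2
    simp only [this]
    ext j
    · simp [origin, Prod.fst_sum]
    · simp [origin, Prod.snd_sum, Finset.sum_apply, Pi.single_apply]
  rw [hx]
  exact S.add_mem (S.smul_mem _ hoS) (S.sum_mem fun i _ => S.smul_mem _ (hES _))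

/-- An invariant bilinear map is proportional to the Lorentzian inner product. -/
lemma eq_mul_ip_of_invariant (hp : Even p)
    (D : LorentzLattice (p + 4) →ₗ[ℤ] LorentzLattice (p + 4) →ₗ[ℤ] ℚ)
    (hshift : ∀ x y, D (shift x) (shift y) = D x y) (hflip : ∀ x y, D (flip x) (flip y) = D x y) :
    ∃ c : ℚ, ∀ x y, D x y = c * ip x y := by
  have hv : ∀ x, D x vneg = -(D vneg vneg) / 2 * ip x vneg := by
    intro x
    have h1 := hflip x vneg
    simp only [flip_apply, ip_vneg_self, map_add, map_smul, LinearMap.add_apply,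
      LinearMap.smul_apply] at h1
    simp only [zsmul_eq_mul] at h1
    push_cast at h1
    linarith
  refine ⟨-(D vneg vneg) / 2, ?_⟩
  set c : ℚ := -(D vneg vneg) / 2
  let S : Submodule ℤ (LorentzLattice (p + 4)) :=
    { carrier := {y | ∀ x, D x y = c * ip x y}
      zero_mem' := fun x => by simp [ip]
      add_mem' := fun {y z} hy hz x => by
        rw [map_add, hy x, hz x, ip_add_right]; push_cast; ring
      smul_mem' := fun a y hy x => by
        rw [map_smul, hy x, ip_smul_right, zsmul_eq_mul]; push_cast; ring }
  have hS : S = ⊤ := by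
    refine eq_top_of_vneg_mem hp S (fun y hy x => ?_) (fun y hy x => ?_) hv
    · have h1 := hy x
      rw [map_smul, ip_smul_right, zsmul_eq_mul] at h1
      push_cast at h1
      linarith
    · have hx : shift (shiftInv x) = x := LinearMap.congr_fun shift_mul_shiftInv x
      rw [← hx, hshift, isIsom_shift]
      exact hy _
  intro x y
  have : y ∈ S := hS ▸ Submodule.mem_top
  exact this x

/-- The bilinear form on integral vectors attached to a rational matrix. -/
def ratForm {n : ℕ} (F : Matrix (Fin n) (Fin n) ℚ) : (Fin n → ℤ) →ₗ[ℤ] (Fin n → ℤ) →ₗ[ℤ] ℚ :=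
  LinearMap.mk₂ ℤ (fun y z => (fun i => (y i : ℚ)) ⬝ᵥ F *ᵥ fun i => (z i : ℚ))
    (fun y y' z => by
      rw [← add_dotProduct]; congr 1; ext i; simp)
    (fun c y z => by
      rw [← smul_dotProduct]; congr 1; ext i; simp)
    (fun y z z' => by
      rw [← dotProduct_add, ← mulVec_add]; congr 2; ext i; simp)
    (fun c y z => by
      rw [← dotProduct_smul, ← mulVec_smul]; congr 2; ext i; simp)

lemma ratForm_apply {n : ℕ} (F : Matrix (Fin n) (Fin n) ℚ) (y z : Fin n → ℤ) :
    ratForm F y z = (fun i => (y i : ℚ)) ⬝ᵥ F *ᵥ fun i => (z i : ℚ) := rfl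

lemma ratForm_mulVec {n : ℕ} (F : Matrix (Fin n) (Fin n) ℚ) (g : Matrix (Fin n) (Fin n) ℤ)
    (y z : Fin n → ℤ) :
    ratForm F (g *ᵥ y) (g *ᵥ z) = ratForm ((qm g)ᵀ * F * qm g) y z := by
  have hc : ∀ y : Fin n → ℤ, (fun i => ((g *ᵥ y) i : ℚ)) = qm g *ᵥ fun i => (y i : ℚ) := by
    intro y; ext i; simp [mulVec, dotProduct, qm]
  simp only [ratForm_apply, hc]
  rw [← mulVec_mulVec, ← mulVec_mulVec, dotProduct_mulVec _ (qm g)ᵀ, vecMul_transpose]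

lemma ratForm_injective {n : ℕ} {F G : Matrix (Fin n) (Fin n) ℚ} (h : ratForm F = ratForm G) :
    F = G := by
  have hs : ∀ i : Fin n, (fun j => ((Pi.single i 1 : Fin n → ℤ) j : ℚ)) = Pi.single i 1 := by
    intro i; ext j; simp [Pi.single_apply]
  ext i j
  have h1 := LinearMap.congr_fun (LinearMap.congr_fun h (Pi.single i 1)) (Pi.single j 1)
  simpa [ratForm_apply, hs] using h1

/-- The integral matrix `g` restricts to the endomorphism `f` of the Lorentzian lattice. -/
def Lifts (g : Matrix (Fin (p + 5)) (Fin (p + 5)) ℤ)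
    (f : Module.End ℤ (LorentzLattice (p + 4))) : Prop := ∀ x, g *ᵥ emb x = emb (f x)

lemma Lifts.mul {g g' : Matrix (Fin (p + 5)) (Fin (p + 5)) ℤ}
    {f f' : Module.End ℤ (LorentzLattice (p + 4))} (h : Lifts g f) (h' : Lifts g' f') :
    Lifts (g * g') (f * f') := fun x => by
  rw [← mulVec_mulVec, h' x, h, Module.End.mul_apply]

lemma lifts_one : Lifts (p := p) 1 1 := fun x => by simp

lemma Lifts.pow {g : Matrix (Fin (p + 5)) (Fin (p + 5)) ℤ}
    {f : Module.End ℤ (LorentzLattice (p + 4))} (h : Lifts g f) (k : ℕ) :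
    Lifts (g ^ k) (f ^ k) := by
  induction k with
  | zero => simpa using lifts_one
  | succ k ih => rw [pow_succ, pow_succ]; exact ih.mul h

lemma Lifts.unique (hp : Even p) {g : Matrix (Fin (p + 5)) (Fin (p + 5)) ℤ}
    {f f' : Module.End ℤ (LorentzLattice (p + 4))} (h : Lifts g f) (h' : Lifts g f') : f = f' :=
  LinearMap.ext fun x => emb_injective hp ((h x).symm.trans (h' x))

lemma Lifts.inv (g : (Matrix (Fin (p + 5)) (Fin (p + 5)) ℤ)ˣ)
    {f f' : Module.End ℤ (LorentzLattice (p + 4))} (h : Lifts (g : Matrix _ _ ℤ) f)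
    (hff : f * f' = 1) : Lifts (g⁻¹ : (Matrix (Fin (p + 5)) (Fin (p + 5)) ℤ)ˣ) f' := fun x => by
  have h1 := h (f' x)
  rw [← Module.End.mul_apply, hff, Module.End.one_apply] at h1
  rw [← h1, mulVec_mulVec, Units.inv_mul, one_mulVec]

lemma exists_invariant_form (hp : Even p) :
    ∃ F : Matrix (Fin (p + 5)) (Fin (p + 5)) ℚ, F ≠ 0 ∧ F.IsSymm ∧
      ∀ g f, Lifts g f → IsIsom f → (qm g)ᵀ * F * qm g = F := by
  obtain ⟨Φ, h1, h2⟩ := exists_quasi_inverse hp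
  let B : LinearMap.BilinForm ℤ (Fin (p + 5) → ℤ) :=
    LinearMap.mk₂ ℤ (fun y z => ip (Φ y) (Φ z)) (fun _ _ _ => by simp)
      (fun c y z => by simp only [map_smul, ip_smul_left, smul_eq_mul]) (fun _ _ _ => by simp)
      (fun c y z => by simp only [map_smul, ip_smul_right, smul_eq_mul])
  have hB : ∀ y z, B y z = ip (Φ y) (Φ z) := fun _ _ => rfl
  have hF : ∀ y z, ratForm (qm B.toMatrix') y z = B y z := by
    intro y z
    conv_rhs => rw [← toBilin'_toMatrix' B, toBilin'_apply']
    simp [ratForm_apply, qm, dotProduct, mulVec]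
  refine ⟨qm B.toMatrix', fun h0 => ?_, ?_, fun g f hg hf => ratForm_injective ?_⟩
  · have := hF (emb origin) (emb origin)
    rw [h0, hB, h2, ip_smul_left, ip_smul_right, ip_origin] at this
    simp [ratForm_apply, origin] at this
  · ext i j
    simp [qm, LinearMap.BilinForm.toMatrix'_apply, hB, ip_comm (Φ (Pi.single j 1))]
  · refine LinearMap.ext fun y => LinearMap.ext fun z => ?_
    have hΦ : ∀ y, Φ (g *ᵥ y) = f (Φ y) := fun y => by
      apply smul_right_injective (LorentzLattice (p + 4)) (four_ne_zero : (4 : ℤ) ≠ 0)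
      change (4 : ℤ) • Φ (g *ᵥ y) = (4 : ℤ) • f (Φ y)
      rw [← map_smul, ← mulVec_smul, ← h1, hg, h2]
    rw [← ratForm_mulVec, hF, hF, hB, hB, hΦ, hΦ, hf]

lemma mem_OFgrp (hp : Even p) {F : Matrix (Fin (p + 5)) (Fin (p + 5)) ℚ}
    (hA : (qm (levelt (p + 5) (cP15 (p + 5))))ᵀ * F * qm (levelt (p + 5) (cP15 (p + 5))) = F)
    (hB : (qm (levelt (p + 5) (cQ15 (p + 5))))ᵀ * F * qm (levelt (p + 5) (cQ15 (p + 5))) = F)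
    {u : (Matrix (Fin (p + 5)) (Fin (p + 5)) ℤ)ˣ} {f : Module.End ℤ (LorentzLattice (p + 4))}
    (hu : Lifts (u : Matrix _ _ ℤ) f) (hf : IsIsom f) : u ∈ OFgrp (p + 5) F := by
  obtain ⟨Φ, h1, h2⟩ := exists_quasi_inverse hp
  let D : LorentzLattice (p + 4) →ₗ[ℤ] LorentzLattice (p + 4) →ₗ[ℤ] ℚ :=
    (ratForm F).compl₁₂ emb emb
  have hD : ∀ x y, D x y = ratForm F (emb x) (emb y) := fun _ _ => rfl
  have hDs : ∀ x y, D (shift x) (shift y) = D x y := fun x y => by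
    rw [hD, hD, ← levelt_cP15_emb, ← levelt_cP15_emb, ratForm_mulVec, hA]
  obtain ⟨c, hc⟩ := eq_mul_ip_of_invariant hp D hDs fun x y => by
    rw [← hDs, hD, hD, ← levelt_cQ15_emb, ← levelt_cQ15_emb, ratForm_mulVec, hB]
  change (qm (u : Matrix _ _ ℤ))ᵀ * F * qm (u : Matrix _ _ ℤ) = F
  refine ratForm_injective (LinearMap.ext fun y => LinearMap.ext fun z => ?_)
  have key : ratForm F ((u : Matrix _ _ ℤ) *ᵥ ((4 : ℤ) • y)) ((u : Matrix _ _ ℤ) *ᵥ ((4 : ℤ) • z)) =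
      ratForm F ((4 : ℤ) • y) ((4 : ℤ) • z) := by
    rw [← h1, ← h1, hu, hu, ← hD, ← hD, hc, hc, hf]
  rw [← ratForm_mulVec]
  simp only [mulVec_smul, map_smul, LinearMap.smul_apply] at key
  simp only [zsmul_eq_mul] at key
  push_cast at key
  linarith

lemma isIsom_reflProd {N : ℕ} {l : List (LorentzLattice N)} (hl : ∀ r ∈ l, ip r r = 1) :
    IsIsom (reflProd l) := by
  induction l with
  | nil => exact fun _ _ => rfl
  | cons r l ih =>
    rw [List.forall_mem_cons] at hl
    exact (isIsom_refl hl.1).mul (ih hl.2)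

lemma reflProd_append {N : ℕ} (l l' : List (LorentzLattice N)) :
    reflProd (l ++ l') = reflProd l * reflProd l' := by simp [reflProd]

lemma reflProd_mul_reverse {N : ℕ} {l : List (LorentzLattice N)} (hl : ∀ r ∈ l, ip r r = 1) :
    reflProd l * reflProd l.reverse = 1 := by
  induction l with
  | nil => rfl
  | cons r l ih =>
    rw [List.forall_mem_cons] at hl
    rw [List.reverse_cons, reflProd_append, ← List.singleton_append, reflProd_append, mul_assoc,
      ← mul_assoc (reflProd l), ih hl.2, one_mul]
    simpa [reflProd] using refl_mul_self hl.1

lemma exists_reflProd_eq {N : ℕ} (l : List (LorentzLattice N)) :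
    ∃ M : Module.End ℤ (LorentzLattice N), reflProd l = 1 + (2 : ℤ) • M := by
  induction l with
  | nil => exact ⟨0, by simp [reflProd]⟩
  | cons r l ih =>
    obtain ⟨M, hM⟩ := ih
    let K : Module.End ℤ (LorentzLattice N) :=
      { toFun := fun x => -ip x r • r
        map_add' := fun x y => by simp only [ip_add_left]; module
        map_smul' := fun c x => by simp only [ip_smul_left, RingHom.id_apply]; module }
    have hK : refl r = 1 + (2 : ℤ) • K := LinearMap.ext fun x => by
      change x - (2 * ip x r) • r = x + (2 : ℤ) • (-ip x r • r)
      module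
    refine ⟨K + M + (2 : ℤ) • (K * M), ?_⟩
    rw [reflProd, List.map_cons, List.prod_cons, hK, ← reflProd, hM]
    simp only [mul_add, add_mul, one_mul, mul_one, smul_mul_assoc, mul_smul_comm]
    module

/-- Squares of products of reflections lift to integral matrices. -/
lemma exists_lifts_sq (hp : Even p) {l : List (LorentzLattice (p + 4))}
    (hl : ∀ r ∈ l, ip r r = 1) :
    ∃ u : (Matrix (Fin (p + 5)) (Fin (p + 5)) ℤ)ˣ, Lifts (u : Matrix _ _ ℤ) (reflProd l ^ 2) := by
  obtain ⟨Φ, h1, h2⟩ := exists_quasi_inverse hp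
  have key : ∀ l : List (LorentzLattice (p + 4)), ∃ g, Lifts g (reflProd l ^ 2) := by
    intro l
    obtain ⟨M, hM⟩ := exists_reflProd_eq l
    refine ⟨LinearMap.toMatrix' (1 + emb ∘ₗ (M + M * M) ∘ₗ Φ), fun x => ?_⟩
    rw [LinearMap.toMatrix'_mulVec, hM]
    simp only [LinearMap.add_apply, LinearMap.comp_apply, h2, Module.End.one_apply, ← map_smul,
      ← map_add, sq, Module.End.mul_apply, LinearMap.smul_apply]
    congr 1
    simp only [map_add, map_smul]
    module
  obtain ⟨g, hg⟩ := key l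
  obtain ⟨g', hg'⟩ := key l.reverse
  have hone : ∀ m, Lifts (p := p) m 1 → m = 1 := fun m hm => ext_iff_mulVec.mpr fun y => by
    apply smul_right_injective _ (four_ne_zero : (4 : ℤ) ≠ 0)
    change (4 : ℤ) • m *ᵥ y = (4 : ℤ) • (1 : Matrix _ _ ℤ) *ᵥ y
    rw [← mulVec_smul, ← h1, hm, Module.End.one_apply, h1, one_mulVec]
  have hsq : ∀ a b : Module.End ℤ (LorentzLattice (p + 4)), a * b = 1 → a ^ 2 * b ^ 2 = 1 :=
    fun a b h => by rw [sq, sq, mul_assoc, ← mul_assoc a b, h, one_mul, h]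
  refine ⟨⟨g, g', hone _ ?_, hone _ ?_⟩, hg⟩
  · rw [← hsq _ _ (reflProd_mul_reverse hl)]; exact hg.mul hg'
  · rw [← hsq _ _ (by simpa using reflProd_mul_reverse (l := l.reverse) (by simpa using hl))]
    exact hg'.mul hg

end

section

variable {p : ℕ}

/-- The symmetry of the origin which together with the reflection in `root0` makes up `-flip`. -/
def twist : Module.End ℤ (LorentzLattice (p + 4)) := -(refl root0 * flip)

lemma twist_snd (x : LorentzLattice (p + 4)) (i : Fin (p + 4)) :
    (twist x).2 i = -x.2 (Equiv.swap 0 1 i) := by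
  have h1 : ip x vneg = -2 * x.1 - x.2 0 + x.2 1 := by
    rw [ip_vneg, co_of_lt _ (by omega), co_of_lt _ (by omega)]; rfl
  simp only [twist, LinearMap.neg_apply, Module.End.mul_apply, refl_apply, flip_apply, ip_root0, h1]
  by_cases hi0 : i = 0
  · subst hi0; simp [vneg, root0]; ring
  by_cases hi1 : i = 1
  · subst hi1; simp [vneg, root0]; ring
  · rw [Equiv.swap_apply_of_ne_of_ne hi0 hi1]; simp [vneg, root0, hi0, hi1]

lemma twist_fst (x : LorentzLattice (p + 4)) : (twist x).1 = x.1 := by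
  have h1 : ip x vneg = -2 * x.1 - x.2 0 + x.2 1 := by
    rw [ip_vneg, co_of_lt _ (by omega), co_of_lt _ (by omega)]; rfl
  simp only [twist, LinearMap.neg_apply, Module.End.mul_apply, refl_apply, flip_apply, ip_root0, h1]
  simp [vneg, root0]; ring

lemma IsIsom.neg {N : ℕ} {g : Module.End ℤ (LorentzLattice N)} (hg : IsIsom g) : IsIsom (-g) :=
  fun x y => by simp [hg x y]

lemma isIsom_twist : IsIsom (twist : Module.End ℤ (LorentzLattice (p + 4))) :=
  ((isIsom_refl isRoot_root0.1).mul isIsom_flip).neg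

lemma flip_eq : (flip : Module.End ℤ (LorentzLattice (p + 4))) = -(refl root0 * twist) := by
  rw [twist, mul_neg, neg_neg, ← mul_assoc, refl_mul_self isRoot_root0.1, one_mul]

lemma isIsom_shiftInv : IsIsom (shiftInv : Module.End ℤ (LorentzLattice (p + 4))) := fun x y => by
  rw [← isIsom_shift, ← Module.End.mul_apply, ← Module.End.mul_apply, shift_mul_shiftInv]; rfl

/-- A product of reflections in roots with a symmetry of the origin, up to sign, subject to
the relation `E` between the two factors. -/
def HasForm (E : List (LorentzLattice (p + 4)) → Module.End ℤ (LorentzLattice (p + 4)) → Prop)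
    (f : Module.End ℤ (LorentzLattice (p + 4))) : Prop :=
  ∃ (ε : ℤ) (l : List (LorentzLattice (p + 4))) (h : Module.End ℤ (LorentzLattice (p + 4))),
    (ε = 1 ∨ ε = -1) ∧ (∀ r ∈ l, IsRoot r) ∧ IsIsom h ∧ h origin = origin ∧ E l h ∧
      f = ε • (reflProd l * h)

/-- Relations compatible with the action of the generators. -/
structure Compatible
    (E : List (LorentzLattice (p + 4)) → Module.End ℤ (LorentzLattice (p + 4)) → Prop) : Prop where
  one : E [] 1
  shift : ∀ l h, E l h → E l (h * -shift)
  shiftInv : ∀ l h, E l h → E l (h * -shiftInv)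
  twist : ∀ l h, E l h → E (l ++ [h root0]) (h * twist)

variable {E : List (LorentzLattice (p + 4)) → Module.End ℤ (LorentzLattice (p + 4)) → Prop}
  {f : Module.End ℤ (LorentzLattice (p + 4))}

lemma hasForm_one (hE : Compatible E) : HasForm E 1 :=
  ⟨1, [], 1, Or.inl rfl, by simp, fun _ _ => rfl, rfl, hE.one, by simp [reflProd]⟩

lemma shiftInv_origin : shiftInv (origin : LorentzLattice (p + 4)) = -origin := by
  have h : shiftInv (shift (origin : LorentzLattice (p + 4))) = origin :=
    LinearMap.congr_fun shiftInv_mul_shift _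
  rw [shift_origin, map_neg] at h
  exact neg_eq_iff_eq_neg.mp h

lemma twist_origin : twist (origin : LorentzLattice (p + 4)) = origin :=
  Prod.ext (twist_fst _) (funext fun i => by rw [twist_snd]; simp [origin])

lemma HasForm.mul_shift (hE : Compatible E) (hf : HasForm E f) : HasForm E (f * shift) := by
  obtain ⟨ε, l, h, hε, hl, hh, ho, hEl, rfl⟩ := hf
  refine ⟨-ε, l, h * -shift, by omega, hl, hh.mul isIsom_shift.neg, ?_, hE.shift l h hEl, ?_⟩
  · simp [shift_origin, ho]
  · simp [mul_assoc]

lemma HasForm.mul_shiftInv (hE : Compatible E) (hf : HasForm E f) : HasForm E (f * shiftInv) := by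
  obtain ⟨ε, l, h, hε, hl, hh, ho, hEl, rfl⟩ := hf
  refine ⟨-ε, l, h * -shiftInv, by omega, hl, hh.mul isIsom_shiftInv.neg, ?_,
    hE.shiftInv l h hEl, ?_⟩
  · simp [shiftInv_origin, ho]
  · simp [mul_assoc]

lemma HasForm.mul_flip (hE : Compatible E) (hf : HasForm E f) : HasForm E (f * flip) := by
  obtain ⟨ε, l, h, hε, hl, hh, ho, hEl, rfl⟩ := hf
  have hroot : IsRoot (h root0) := by
    refine ⟨(hh _ _).trans isRoot_root0.1, ?_⟩
    have h1 := hh root0 origin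
    rw [ho, ip_origin, ip_origin, isRoot_root0.2] at h1
    linarith
  have hcomm : h * refl root0 = refl (h root0) * h := LinearMap.ext fun x => hh.refl_apply _ _
  refine ⟨-ε, l ++ [h root0], h * twist, by omega, ?_, hh.mul isIsom_twist, ?_,
    hE.twist l h hEl, ?_⟩
  · intro r hr
    rcases List.mem_append.mp hr with hr | hr
    · exact hl r hr
    · rw [List.mem_singleton.mp hr]; exact hroot
  · simp [twist_origin, ho]
  · have h1 : reflProd [h root0] = refl (h root0) := by simp [reflProd]
    rw [flip_eq, reflProd_append, h1, mul_neg, smul_mul_assoc, mul_assoc (reflProd l),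
      ← mul_assoc h, hcomm]
    simp [mul_assoc]

lemma exists_hasForm_of_mem_closure (hE : Compatible E)
    {gA gB : (Matrix (Fin (p + 5)) (Fin (p + 5)) ℤ)ˣ}
    (hA : (gA : Matrix (Fin (p + 5)) (Fin (p + 5)) ℤ) = levelt (p + 5) (cP15 (p + 5)))
    (hB : (gB : Matrix (Fin (p + 5)) (Fin (p + 5)) ℤ) = levelt (p + 5) (cQ15 (p + 5)))
    {g : (Matrix (Fin (p + 5)) (Fin (p + 5)) ℤ)ˣ} (hg : g ∈ Subgroup.closure {gA, gB}) :
    ∃ f, Lifts (g : Matrix _ _ ℤ) f ∧ HasForm E f := by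
  have lA : Lifts (gA : Matrix (Fin (p + 5)) (Fin (p + 5)) ℤ) shift := fun x => by
    rw [hA, levelt_cP15_emb]
  have lB : Lifts (gB : Matrix (Fin (p + 5)) (Fin (p + 5)) ℤ) (shift * flip) := fun x => by
    rw [hB, levelt_cQ15_emb, Module.End.mul_apply]
  have lA' := lA.inv (f' := shiftInv) gA shift_mul_shiftInv
  have lB' := lB.inv (f' := flip * shiftInv) gB (by
    rw [mul_assoc, ← mul_assoc flip, flip_mul_flip, one_mul, shift_mul_shiftInv])
  induction hg using Subgroup.closure_induction_right with
  | one => exact ⟨1, by simpa using lifts_one, hasForm_one hE⟩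
  | mul_right x _ y hy ih =>
    obtain ⟨f, hf, hff⟩ := ih
    rcases hy with rfl | rfl
    · exact ⟨_, by simpa using hf.mul lA, hff.mul_shift hE⟩
    · exact ⟨_, by simpa using hf.mul lB, by
        rw [← mul_assoc]; exact (hff.mul_shift hE).mul_flip hE⟩
  | mul_inv_cancel x _ y hy ih =>
    obtain ⟨f, hf, hff⟩ := ih
    rcases hy with rfl | rfl
    · exact ⟨_, by rw [Units.val_mul]; exact hf.mul lA', hff.mul_shiftInv hE⟩
    · exact ⟨_, by rw [Units.val_mul]; exact hf.mul lB', by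
        rw [← mul_assoc]; exact (hff.mul_flip hE).mul_shiftInv hE⟩

/-- The subgroup generated by the two companion matrices has infinite index as soon as no
proper power of a product of reflections moves the origin as a member of the subgroup does. -/
lemma relIndex_eq_zero (hp : Even p) (hE : Compatible E)
    {F : Matrix (Fin (p + 5)) (Fin (p + 5)) ℚ}
    (hFA : (qm (levelt (p + 5) (cP15 (p + 5))))ᵀ * F * qm (levelt (p + 5) (cP15 (p + 5))) = F)
    (hFB : (qm (levelt (p + 5) (cQ15 (p + 5))))ᵀ * F * qm (levelt (p + 5) (cQ15 (p + 5))) = F)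
    {gA gB : (Matrix (Fin (p + 5)) (Fin (p + 5)) ℤ)ˣ}
    (hA : (gA : Matrix (Fin (p + 5)) (Fin (p + 5)) ℤ) = levelt (p + 5) (cP15 (p + 5)))
    (hB : (gB : Matrix (Fin (p + 5)) (Fin (p + 5)) ℤ) = levelt (p + 5) (cQ15 (p + 5)))
    {L : List (LorentzLattice (p + 4))} (hL : ∀ r ∈ L, ip r r = 1)
    (hfst : ∀ k, 0 < ((reflProd L ^ k) origin).1)
    (hne : ∀ k l h, 0 < k → (∀ r ∈ l, IsRoot r) → E l h →
      (reflProd L ^ k) origin ≠ reflProd l origin) :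
    (Subgroup.closure {gA, gB}).relIndex (OFgrp (p + 5) F) = 0 := by
  by_contra hidx
  obtain ⟨u, hu⟩ := exists_lifts_sq hp hL
  have hiso := (isIsom_reflProd hL).mul (isIsom_reflProd hL)
  rw [← sq] at hiso
  obtain ⟨k, hk, -, hmem⟩ :=
    Subgroup.exists_pow_mem_of_relIndex_ne_zero hidx (mem_OFgrp hp hFA hFB hu hiso)
  obtain ⟨f, hf, ε, l, h, hε, hl, -, ho, hEl, rfl⟩ :=
    exists_hasForm_of_mem_closure hE hA hB hmem.1
  have huk : Lifts ((u ^ k : (Matrix (Fin (p + 5)) (Fin (p + 5)) ℤ)ˣ) : Matrix _ _ ℤ)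
      (reflProd L ^ (2 * k)) := by
    rw [pow_mul, Units.val_pow_eq_pow_val]; exact hu.pow k
  have heq := LinearMap.congr_fun (huk.unique hp hf) origin
  rw [LinearMap.smul_apply, Module.End.mul_apply, ho] at heq
  rcases hε with rfl | rfl
  · exact hne (2 * k) l h (by omega) hl hEl (by simpa using heq)
  · have h1 := hfst (2 * k)
    have h2 := (good_reflProd hl).1
    rw [heq] at h1
    simp at h1
    omega

end

section

variable {q : ℕ}

/-- A vector of norm one violating the linear inequality for the orbit of the origin. -/
def longRoot : LorentzLattice (q + 2 + 4) := (2, fun i => if (i : ℕ) < 5 then 1 else 0)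

/-- A root whose sum with `longRoot` is isotropic. -/
def shortRoot : LorentzLattice (q + 2 + 4) :=
  (1, fun i => if (i : ℕ) = 4 ∨ (i : ℕ) = 5 then 1 else 0)

lemma ip_longRoot_self : ip (longRoot : LorentzLattice (q + 2 + 4)) longRoot = 1 := by
  have h (x : ℕ) : ¬x + 1 + 1 + 1 + 1 + 1 + 1 < 5 := by omega
  simp [ip, longRoot, dotProduct, Fin.sum_univ_succ, h]

lemma ip_shortRoot_self : ip (shortRoot : LorentzLattice (q + 2 + 4)) shortRoot = 1 := by
  simp [ip, shortRoot, dotProduct, Fin.sum_univ_succ]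

lemma ip_longRoot_shortRoot : ip (longRoot : LorentzLattice (q + 2 + 4)) shortRoot = -1 := by
  simp [ip, longRoot, shortRoot, dotProduct, Fin.sum_univ_succ]

lemma reflProd_pow_origin (k : ℕ) :
    (reflProd [longRoot, shortRoot] ^ k) (origin : LorentzLattice (q + 2 + 4)) =
      origin + (6 * k ^ 2 + 2 * k : ℤ) • longRoot + (6 * k ^ 2 - 4 * k : ℤ) • shortRoot := by
  induction k with
  | zero => simp
  | succ k ih =>
    have h1 : reflProd [longRoot, (shortRoot : LorentzLattice (q + 2 + 4))] =
      refl longRoot * refl shortRoot := by simp [reflProd]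
    have h2 : ip (origin : LorentzLattice (q + 2 + 4)) longRoot = -2 := by
      rw [ip_comm, ip_origin]; rfl
    have h3 : ip (origin : LorentzLattice (q + 2 + 4)) shortRoot = -1 := by
      rw [ip_comm, ip_origin]; rfl
    rw [pow_succ', Module.End.mul_apply, ih, h1, Module.End.mul_apply]
    simp only [refl_apply, ip_add_left, ip_sub_left, ip_smul_left, ip_longRoot_self,
      ip_shortRoot_self, ip_longRoot_shortRoot, ip_comm shortRoot longRoot, h2, h3]
    push_cast
    module

lemma relIndex_eq_zero_of_two_le {p : ℕ} (hp : Even p) (hp2 : 2 ≤ p)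
    {F : Matrix (Fin (p + 5)) (Fin (p + 5)) ℚ}
    (hFA : (qm (levelt (p + 5) (cP15 (p + 5))))ᵀ * F * qm (levelt (p + 5) (cP15 (p + 5))) = F)
    (hFB : (qm (levelt (p + 5) (cQ15 (p + 5))))ᵀ * F * qm (levelt (p + 5) (cQ15 (p + 5))) = F)
    {gA gB : (Matrix (Fin (p + 5)) (Fin (p + 5)) ℤ)ˣ}
    (hA : (gA : Matrix (Fin (p + 5)) (Fin (p + 5)) ℤ) = levelt (p + 5) (cP15 (p + 5)))
    (hB : (gB : Matrix (Fin (p + 5)) (Fin (p + 5)) ℤ) = levelt (p + 5) (cQ15 (p + 5))) :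
    (Subgroup.closure {gA, gB}).relIndex (OFgrp (p + 5) F) = 0 := by
  obtain ⟨q, rfl⟩ : ∃ q, p = q + 2 := ⟨p - 2, by omega⟩
  refine relIndex_eq_zero (E := fun _ _ => True) hp
    ⟨trivial, fun _ _ _ => trivial, fun _ _ _ => trivial, fun _ _ _ => trivial⟩ hFA hFB hA hB
    (L := [longRoot, shortRoot]) ?_ (fun k => ?_) fun k l _ hk hl _ heq => ?_
  · simp only [List.forall_mem_cons]
    exact ⟨ip_longRoot_self, ip_shortRoot_self, by simp⟩
  · rw [reflProd_pow_origin]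
    simp only [origin, longRoot, shortRoot, Prod.fst_add, Prod.smul_fst, smul_eq_mul]
    rcases Nat.eq_zero_or_pos k with rfl | hk
    · simp
    · have : (1 : ℤ) ≤ k := by exact_mod_cast hk
      nlinarith
  · have h1 := sum_le_two_mul_fst hl
    rw [← heq, reflProd_pow_origin] at h1
    have hs1 : ∑ i, (longRoot : LorentzLattice (q + 2 + 4)).2 i = 5 := by
      have h (x : ℕ) : ¬x + 1 + 1 + 1 + 1 + 1 + 1 < 5 := by omega
      simp [longRoot, Fin.sum_univ_succ, h, -Finset.sum_boole]
    have hs2 : ∑ i, (shortRoot : LorentzLattice (q + 2 + 4)).2 i = 2 := by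
      simp [shortRoot, Fin.sum_univ_succ, -Finset.sum_boole]
    have hs0 : ∑ i, (origin : LorentzLattice (q + 2 + 4)).2 i = 0 := by simp [origin]
    have ho : (origin : LorentzLattice (q + 2 + 4)).1 = 1 := rfl
    have hl1 : (longRoot : LorentzLattice (q + 2 + 4)).1 = 2 := rfl
    have hs : (shortRoot : LorentzLattice (q + 2 + 4)).1 = 1 := rfl
    simp only [Prod.fst_add, Prod.smul_fst, smul_eq_mul, Prod.snd_add, Prod.smul_snd, Pi.add_apply,
      Pi.smul_apply, Finset.sum_add_distrib, ← Finset.mul_sum, hs0, hs1, hs2, ho, hl1, hs] at h1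
    have : (1 : ℤ) ≤ k := by exact_mod_cast hk
    nlinarith

end

/-- Whether two consecutive entries differ, in the anti-periodic continuation. -/
def alternates (s : Fin 4 → Bool) : Fin 4 → Bool :=
  ![s 0 != s 1, s 1 != s 2, s 2 != s 3, s 3 == s 0]

/-- The places followed by three alternating signs. -/
def defect (s : Fin 4 → Bool) (i : Fin 4) : ZMod 2 :=
  if alternates s (i + 1) && alternates s (i + 2) then 1 else 0

/-- The mod two vector of a root of type `root0` with the given signs. -/
def parityVec (s : Fin 4 → Bool) (i : Fin 4) : ZMod 2 :=
  if s 0 != s 1 && i != 0 && i != 1 then 1 else 0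

/-- The signs after composing with the anti-cyclic shift. -/
def shiftSign (s : Fin 4 → Bool) : Fin 4 → Bool := ![!s 1, !s 2, !s 3, s 0]

/-- The signs after composing with the inverse of the anti-cyclic shift. -/
def shiftInvSign (s : Fin 4 → Bool) : Fin 4 → Bool := ![s 3, !s 0, !s 1, !s 2]

lemma defect_shiftSign : ∀ s i, defect (shiftSign s) i = defect s (i + 1) := by decide

lemma defect_shiftInvSign : ∀ s i, defect (shiftInvSign s) i = defect s (i - 1) := by decide

lemma defect_twist : ∀ s i, defect (fun j => !s (Equiv.swap 0 1 j)) i =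
    defect s (Equiv.swap 0 1 i) + parityVec s (Equiv.swap 0 1 i) := by decide

lemma defect_ne : ∀ s, ∃ i, defect s i ≠ 1 := by decide

lemma defect_add_parityVec_ne : ∀ s, ∃ i, defect s i + parityVec s i ≠ 1 := by decide

/-- The state space of the four-dimensional case. -/
abbrev State : Type := (Fin 4 → ZMod 2) × ℤ

/-- The change of counter at the all-ones vector. -/
def counter : Equiv.Perm State where
  toFun x := (x.1, x.2 + if x.1 = 1 then 1 else 0)
  invFun x := (x.1, x.2 - if x.1 = 1 then 1 else 0)
  left_inv x := by simp
  right_inv x := by simp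

/-- Reduction of one plus the coordinates modulo two. -/
def mask (r : LorentzLattice 4) (i : Fin 4) : ZMod 2 := 1 + (r.2 i : ZMod 2)

/-- Translation of the vector part by `v`. -/
def translation (v : Fin 4 → ZMod 2) : Equiv.Perm State := Equiv.addRight (v, 0)

/-- The action of the reflections in the roots on states. -/
def act (r : LorentzLattice 4) : Equiv.Perm State :=
  if ∑ i, r.2 i = 2 then translation (mask r)
  else if ∑ i, r.2 i = -2 then counter * translation (mask r) * counter⁻¹
  else 1

lemma translation_mul (v w : Fin 4 → ZMod 2) :
    translation v * translation w = translation (w + v) := by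
  ext x <;> simp [translation, add_assoc]

lemma translation_zero : translation 0 = 1 := by
  ext x <;> simp [translation]

lemma act_mul_self (r : LorentzLattice 4) : act r * act r = 1 := by
  have h : translation (mask r) * translation (mask r) = 1 := by
    rw [translation_mul, CharTwo.add_self_eq_zero, translation_zero]
  unfold act
  split_ifs
  · exact h
  · simp only [mul_assoc, inv_mul_cancel_left]
    rw [← mul_assoc (translation _), h, one_mul, mul_inv_cancel]
  · exact one_mul 1

lemma IsRoot.dotProduct_self {N : ℕ} {r : LorentzLattice N} (hr : IsRoot r) : r.2 ⬝ᵥ r.2 = 2 := by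
  have h := hr.1
  simp only [ip, hr.2] at h
  linarith

lemma nonneg_of_sum_eq {r : LorentzLattice 4} (hr : IsRoot r) (h : ∑ i, r.2 i = 2) (i : Fin 4) :
    0 ≤ r.2 i := by
  have h0 : ∑ i, (r.2 i * r.2 i - r.2 i) = 0 := by
    rw [Finset.sum_sub_distrib, h, ← dotProduct, hr.dotProduct_self, sub_self]
  have h1 := (Finset.sum_eq_zero_iff_of_nonneg fun i _ => by
    nlinarith [Int.le_self_sq (r.2 i)]).mp h0 i (Finset.mem_univ i)
  nlinarith [mul_self_nonneg (r.2 i)]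

lemma nonpos_of_sum_eq {r : LorentzLattice 4} (hr : IsRoot r) (h : ∑ i, r.2 i = -2) (i : Fin 4) :
    r.2 i ≤ 0 := by
  have h0 := nonneg_of_sum_eq (r := (r.1, -r.2)) ⟨by simpa [ip] using hr.1, hr.2⟩ (by simp [h]) i
  simpa using h0

lemma ip_ne_zero_of_sum_eq {r q : LorentzLattice 4} (hr : IsRoot r) (hq : IsRoot q)
    (h : ∑ i, r.2 i = 2) (h' : ∑ i, q.2 i = -2) : ip r q ≠ 0 := by
  have h1 : r.2 ⬝ᵥ q.2 ≤ 0 := Finset.sum_nonpos fun i _ =>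
    mul_nonpos_of_nonneg_of_nonpos (nonneg_of_sum_eq hr h i) (nonpos_of_sum_eq hq h' i)
  simp only [ip, hr.2, hq.2]
  omega

lemma act_comm {r q : LorentzLattice 4} (hr : IsRoot r) (hq : IsRoot q) (h : ip r q = 0) :
    act r * act q = act q * act r := by
  have ht : translation (mask r) * translation (mask q) =
      translation (mask q) * translation (mask r) := by
    rw [translation_mul, translation_mul, add_comm]
  by_cases h1 : ∑ i, r.2 i = 2 <;> by_cases h2 : ∑ i, q.2 i = 2
  · simp only [act, h1, h2, if_true, ht]
  · by_cases h3 : ∑ i, q.2 i = -2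
    · exact absurd h (ip_ne_zero_of_sum_eq hr hq h1 h3)
    · simp only [act, h2, h3, if_false, mul_one, one_mul]
  · by_cases h3 : ∑ i, r.2 i = -2
    · exact absurd (by rwa [ip_comm]) (ip_ne_zero_of_sum_eq hq hr h2 h3)
    · simp only [act, h1, h3, if_false, mul_one, one_mul]
  · simp only [act, h1, h2, if_false]
    split_ifs
    · simp only [mul_assoc, inv_mul_cancel_left]
      rw [← mul_assoc (translation _), ht, mul_assoc]
    all_goals simp

/-- The integer attached to a sign. -/
def sgn (b : Bool) : ℤ := if b then 1 else -1

/-- The symmetry `h` of the origin is the signed permutation given by `π` and `s`. -/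
def IsSigned (h : Module.End ℤ (LorentzLattice 4)) (π : Equiv.Perm (Fin 4)) (s : Fin 4 → Bool) :
    Prop := ∀ x i, (h x).2 (π i) = sgn (s i) * x.2 i

/-- The relation between a product of roots and a symmetry of the origin tracked along words in
the generators. -/
def Tracks (l : List (LorentzLattice 4)) (h : Module.End ℤ (LorentzLattice 4)) : Prop :=
  ∃ π s, IsSigned h π s ∧ (l.map act).prod (fun i => defect s (π.symm i), 0) = 0

lemma shift_snd (x : LorentzLattice 4) : (shift (p := 0) x).2 = ![-x.2 3, x.2 0, x.2 1, x.2 2] := by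
  ext i; fin_cases i <;> rfl

lemma shiftInv_snd (x : LorentzLattice 4) :
    (shiftInv (p := 0) x).2 = ![x.2 1, x.2 2, x.2 3, -x.2 0] := by
  ext i; fin_cases i <;> rfl

lemma sgn_not (b : Bool) : sgn (!b) = -sgn b := by cases b <;> rfl

lemma act_apply_of_isSigned {h : Module.End ℤ (LorentzLattice 4)} {π : Equiv.Perm (Fin 4)}
    {s : Fin 4 → Bool} (hh : IsSigned h π s) :
    act (h (root0 (p := 0))) (fun i => defect s (π.symm i) + parityVec s (π.symm i), 0) =
      (fun i => defect s (π.symm i), 0) := by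
  have hr : ∀ i, (h (root0 (p := 0))).2 (π i) = sgn (s i) * (root0 (p := 0)).2 i := hh _
  have hsum : ∑ i, (h (root0 (p := 0))).2 i = sgn (s 1) - sgn (s 0) := by
    rw [← Equiv.sum_comp π]
    simp only [hr, Fin.sum_univ_four]
    simp [root0]
    ring
  have hmask : ∀ i, s 0 ≠ s 1 → mask (h (root0 (p := 0))) i = parityVec s (π.symm i) := by
    intro i hs
    obtain ⟨i, rfl⟩ := π.surjective i
    rw [mask, hr, Equiv.symm_apply_apply]
    cases h0 : s 0 <;> cases h1 : s 1 <;> rw [h0, h1] at hs <;> try exact absurd rfl hs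
    all_goals fin_cases i <;> simp [root0, parityVec, h0, h1, sgn] <;> rfl
  have hn1 : (fun i => defect s (π.symm i)) ≠ 1 := fun hc => by
    obtain ⟨i, hi⟩ := defect_ne s
    exact hi (by simpa using congrFun hc (π i))
  have hn2 : (fun i => defect s (π.symm i) + parityVec s (π.symm i)) ≠ 1 := fun hc => by
    obtain ⟨i, hi⟩ := defect_add_parityVec_ne s
    exact hi (by simpa using congrFun hc (π i))
  by_cases hs : s 0 = s 1
  · have h0 : act (h (root0 (p := 0))) = 1 := by simp [act, hsum, hs]
    simp [h0, parityVec, hs]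
  have ht : translation (mask (h (root0 (p := 0))))
      (fun i => defect s (π.symm i) + parityVec s (π.symm i), 0) =
      (fun i => defect s (π.symm i), 0) := by
    refine Prod.ext (funext fun i => ?_) (by simp [translation])
    simp [translation, hmask i hs, add_assoc, CharTwo.add_self_eq_zero]
  have hc : ∀ v, v ≠ 1 → counter (v, 0) = (v, 0) := fun v hv => by simp [counter, hv]
  have hor : ∑ i, (h (root0 (p := 0))).2 i = 2 ∨ ∑ i, (h (root0 (p := 0))).2 i = -2 := by
    rw [hsum]
    cases h0 : s 0 <;> cases h1 : s 1 <;> rw [h0, h1] at hs <;> simp [sgn] at hs ⊢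
  rcases hor with h2 | h2
  · simp only [act, h2, if_true, ht]
  · have h3 : counter⁻¹ (fun i => defect s (π.symm i) + parityVec s (π.symm i), 0) =
        (fun i => defect s (π.symm i) + parityVec s (π.symm i), 0) := by
      rw [Equiv.Perm.inv_eq_iff_eq, hc _ hn2]
    rw [act, if_neg (by rw [h2]; decide), if_pos h2, Equiv.Perm.mul_apply, Equiv.Perm.mul_apply,
      h3, ht, hc _ hn1]

lemma compatible_tracks : Compatible (p := 0) Tracks where
  one := ⟨1, fun _ => true, fun x i => by simp [sgn], by decide⟩
  shift := by
    rintro l h ⟨π, s, hh, hl⟩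
    refine ⟨(Equiv.addRight 1).trans π, shiftSign s, fun x i => ?_, ?_⟩
    · have := hh (-shift (p := 0) x) (i + 1)
      simp only [Prod.snd_neg, Pi.neg_apply, shift_snd] at this
      simp only [Equiv.trans_apply, Equiv.coe_addRight, Module.End.mul_apply, LinearMap.neg_apply]
      rw [this]
      fin_cases i <;> simp [shiftSign, sgn_not]
    · simpa [defect_shiftSign] using hl
  shiftInv := by
    rintro l h ⟨π, s, hh, hl⟩
    refine ⟨(Equiv.addRight (-1)).trans π, shiftInvSign s, fun x i => ?_, ?_⟩
    · have := hh (-shiftInv (p := 0) x) (i + -1)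
      simp only [Prod.snd_neg, Pi.neg_apply, shiftInv_snd] at this
      simp only [Equiv.trans_apply, Equiv.coe_addRight, Module.End.mul_apply, LinearMap.neg_apply]
      rw [this]
      have h3 : (-1 : Fin 4) = 3 := rfl
      have h1 : (2 : Fin 4) + 3 = 1 := rfl
      have h2 : (3 : Fin 4) + 3 = 2 := rfl
      fin_cases i <;> simp [shiftInvSign, sgn_not, h1, h2, h3]
    · simpa [defect_shiftInvSign] using hl
  twist := by
    rintro l h ⟨π, s, hh, hl⟩
    refine ⟨(Equiv.swap 0 1).trans π, fun j => !s (Equiv.swap 0 1 j), fun x i => ?_, ?_⟩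
    · have := hh (twist (p := 0) x) (Equiv.swap 0 1 i)
      rw [twist_snd, Equiv.swap_apply_self] at this
      rw [Equiv.trans_apply, Module.End.mul_apply, this, sgn_not]; ring
    · rw [List.map_append, List.prod_append, List.map_singleton, List.prod_singleton,
        Equiv.Perm.mul_apply, ← hl]
      congr 1
      convert act_apply_of_isSigned hh using 3
      ext i
      simp [defect_twist]

/-- Four roots whose product of reflections has infinite order and raises the counter. -/
def counterRoots : List (LorentzLattice 4) :=
  [(1, ![1, 1, 0, 0]), (1, ![0, 0, 1, 1]), (1, ![-1, -1, 0, 0]), (1, ![0, 0, -1, -1])]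

lemma isRoot_of_mem_counterRoots : ∀ r ∈ counterRoots, IsRoot r := by
  simp [counterRoots, IsRoot, ip, dotProduct, Fin.sum_univ_succ]

lemma counterRoots_act_apply (n : ℤ) : (counterRoots.map act).prod (0, n) = (0, n + 1) := by
  have hm1 : ∀ n : ℤ, mask (n, ![1, 1, 0, 0]) = ![0, 0, 1, 1] := fun n => by
    ext i; fin_cases i <;> simp [mask] <;> rfl
  have hm2 : ∀ n : ℤ, mask (n, ![0, 0, 1, 1]) = ![1, 1, 0, 0] := fun n => by
    ext i; fin_cases i <;> simp [mask] <;> rfl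
  have hm3 : ∀ n : ℤ, mask (n, ![-1, -1, 0, 0]) = ![0, 0, 1, 1] := fun n => by
    ext i; fin_cases i <;> simp [mask] <;> rfl
  have hm4 : ∀ n : ℤ, mask (n, ![0, 0, -1, -1]) = ![1, 1, 0, 0] := fun n => by
    ext i; fin_cases i <;> simp [mask] <;> rfl
  have hc : ∀ v n, v ≠ 1 → counter (v, n) = (v, n) := fun v n hv => by simp [counter, hv]
  have hc' : ∀ v n, v ≠ 1 → counter.symm (v, n) = (v, n) := fun v n hv => by
    rw [Equiv.symm_apply_eq, hc _ _ hv]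
  have hc1 : counter (1, n) = (1, n + 1) := by simp [counter]
  have ht : ∀ v w n, translation v (w, n) = (w + v, n) := fun v w n => by simp [translation]
  have e1 : (0 : Fin 4 → ZMod 2) + ![1, 1, 0, 0] = ![1, 1, 0, 0] := by decide
  have e2 : ![1, 1, 0, 0] + ![0, 0, 1, 1] = (1 : Fin 4 → ZMod 2) := by decide
  have e3 : (1 : Fin 4 → ZMod 2) + ![1, 1, 0, 0] = ![0, 0, 1, 1] := by decide
  have e4 : ![0, 0, 1, 1] + ![0, 0, 1, 1] = (0 : Fin 4 → ZMod 2) := by decide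
  have n2 : (0 : Fin 4 → ZMod 2) ≠ 1 := by decide
  simp only [counterRoots, List.map_cons, List.map_nil, List.prod_cons, List.prod_nil, act,
    Fin.sum_univ_four, hm1, hm2, hm3, hm4]
  simp only [Matrix.cons_val, Equiv.Perm.mul_apply, Equiv.Perm.one_apply]
  norm_num
  rw [hc' _ _ n2, ht _ 0, e1, ht _ ![1, 1, 0, 0], e2, hc1, ht _ 1, e3, ht, e4]

lemma exists_counterRoots_pow (k : ℕ) : ∃ l : List (LorentzLattice 4), (∀ r ∈ l, IsRoot r) ∧
    reflProd l = reflProd counterRoots ^ k ∧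
      (l.map act).prod = (counterRoots.map act).prod ^ k := by
  induction k with
  | zero => exact ⟨[], by simp, by simp [reflProd], by simp⟩
  | succ k ih =>
    obtain ⟨l, h1, h2, h3⟩ := ih
    refine ⟨l ++ counterRoots, fun r hr => ?_, ?_, ?_⟩
    · exact (List.mem_append.mp hr).elim (h1 r) (isRoot_of_mem_counterRoots r)
    · rw [reflProd_append, h2, pow_succ]
    · rw [List.map_append, List.prod_append, h3, pow_succ]

lemma counterRoots_act_pow_apply (k : ℕ) (n : ℤ) :
    ((counterRoots.map act).prod ^ k) (0, n) = (0, n + k) := by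
  induction k with
  | zero => simp
  | succ k ih =>
    rw [pow_succ', Equiv.Perm.mul_apply, ih, counterRoots_act_apply]
    push_cast
    rw [add_assoc]

lemma relIndex_eq_zero_of_eq_zero
    {F : Matrix (Fin (0 + 5)) (Fin (0 + 5)) ℚ}
    (hFA : (qm (levelt (0 + 5) (cP15 (0 + 5))))ᵀ * F * qm (levelt (0 + 5) (cP15 (0 + 5))) = F)
    (hFB : (qm (levelt (0 + 5) (cQ15 (0 + 5))))ᵀ * F * qm (levelt (0 + 5) (cQ15 (0 + 5))) = F)
    {gA gB : (Matrix (Fin (0 + 5)) (Fin (0 + 5)) ℤ)ˣ}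
    (hA : (gA : Matrix (Fin (0 + 5)) (Fin (0 + 5)) ℤ) = levelt (0 + 5) (cP15 (0 + 5)))
    (hB : (gB : Matrix (Fin (0 + 5)) (Fin (0 + 5)) ℤ) = levelt (0 + 5) (cQ15 (0 + 5))) :
    (Subgroup.closure {gA, gB}).relIndex (OFgrp (0 + 5) F) = 0 := by
  refine relIndex_eq_zero Even.zero compatible_tracks hFA hFB hA hB (L := counterRoots)
    (fun r hr => (isRoot_of_mem_counterRoots r hr).1) (fun k => ?_) fun k l h hk hl hE heq => ?_
  · obtain ⟨L, hL, h2, -⟩ := exists_counterRoots_pow k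
    rw [← h2]
    exact (good_reflProd hL).1
  · obtain ⟨L, hL, h2, h3⟩ := exists_counterRoots_pow k
    have h4 := descend_reflProd (p := act) (fun r _ => act_mul_self r)
      (fun r q hr hq => act_comm hr hq) hl
    have h5 := descend_reflProd (p := act) (fun r _ => act_mul_self r)
      (fun r q hr hq => act_comm hr hq) hL
    obtain ⟨π, s, -, hs⟩ := hE
    have h6 : (l.map act).prod (0, -(k : ℤ)) = 0 := by
      rw [← h4, ← heq, ← h2, h5, h3, counterRoots_act_pow_apply]
      simp
    have h7 := congrArg Prod.snd ((l.map act).prod.injective (hs.trans h6.symm))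
    simp only at h7
    omega

end LorentzLattice

theorem stmt15 (n : ℕ) (hn : 5 ≤ n) (hodd : Odd n) :
    (∃ F : Matrix (Fin n) (Fin n) ℚ, F ≠ 0 ∧ F.IsSymm ∧
      (qm (levelt n (cP15 n)))ᵀ * F * qm (levelt n (cP15 n)) = F ∧
      (qm (levelt n (cQ15 n)))ᵀ * F * qm (levelt n (cQ15 n)) = F) ∧
    ∀ F : Matrix (Fin n) (Fin n) ℚ, F ≠ 0 → F.IsSymm →
      (qm (levelt n (cP15 n)))ᵀ * F * qm (levelt n (cP15 n)) = F →
      (qm (levelt n (cQ15 n)))ᵀ * F * qm (levelt n (cQ15 n)) = F →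
      ∀ gA gB : (Matrix (Fin n) (Fin n) ℤ)ˣ,
        (gA : Matrix (Fin n) (Fin n) ℤ) = levelt n (cP15 n) →
        (gB : Matrix (Fin n) (Fin n) ℤ) = levelt n (cQ15 n) →
        (Subgroup.closure {gA, gB}).relIndex (OFgrp n F) = 0 := by
  obtain ⟨p, rfl⟩ : ∃ p, n = p + 5 := ⟨n - 5, by omega⟩
  have hp : Even p := by
    rcases Nat.even_or_odd p with h | h
    · exact h
    · exact absurd hodd (Nat.not_odd_iff_even.mpr (h.add_odd (by decide)))
  refine ⟨?_, fun F _ _ hFA hFB gA gB hA hB => ?_⟩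
  · obtain ⟨F, h0, hs, hF⟩ := LorentzLattice.exists_invariant_form hp
    exact ⟨F, h0, hs, hF _ _ LorentzLattice.levelt_cP15_emb LorentzLattice.isIsom_shift,
      hF _ (LorentzLattice.shift * LorentzLattice.flip) (fun x => LorentzLattice.levelt_cQ15_emb x)
        (LorentzLattice.isIsom_shift.mul LorentzLattice.isIsom_flip)⟩
  · rcases Nat.eq_zero_or_pos p with rfl | hpos
    · exact LorentzLattice.relIndex_eq_zero_of_eq_zero hFA hFB hA hB
    · exact LorentzLattice.relIndex_eq_zero_of_two_le hp (by obtain ⟨m, rfl⟩ := hp; omega)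
        hFA hFB hA hB
end
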